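/- arXiv:2602.07944 — 10 statements merged into one kernel-verified Lean document; each statement's English description precedes it below -/
import Mathlib

section
/- Let A and B be n×n real symmetric positive-definite matrices and let u, v ∈ ℝⁿ. Then uᵀAu + vᵀBv − (u+v)ᵀ(A⁻¹+B⁻¹)⁻¹(u+v) = (Au − Bv)ᵀ(A+B)⁻¹(Au − Bv). In particular, uᵀAu + vᵀBv ≥ (u+v)ᵀ(A⁻¹+B⁻¹)⁻¹(u+v). -/
open Matrix

/-- Lemma: for symmetric positive-definite `A`, `B` and vectors `u`, `v`,
`uᵀAu + vᵀBv − (u+v)ᵀ(A⁻¹+B⁻¹)⁻¹(u+v) = (Au − Bv)ᵀ(A+B)⁻¹(Au − Bv)`,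
and in particular `uᵀAu + vᵀBv ≥ (u+v)ᵀ(A⁻¹+B⁻¹)⁻¹(u+v)`. -/
theorem stmt0 {n : ℕ} (A B : Matrix (Fin n) (Fin n) ℝ)
    (hA : A.PosDef) (hB : B.PosDef) (u v : Fin n → ℝ) :
    u ⬝ᵥ (A *ᵥ u) + v ⬝ᵥ (B *ᵥ v)
        - (u + v) ⬝ᵥ ((A⁻¹ + B⁻¹)⁻¹ *ᵥ (u + v))
      = (A *ᵥ u - B *ᵥ v) ⬝ᵥ ((A + B)⁻¹ *ᵥ (A *ᵥ u - B *ᵥ v)) ∧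
    (u + v) ⬝ᵥ ((A⁻¹ + B⁻¹)⁻¹ *ᵥ (u + v))
      ≤ u ⬝ᵥ (A *ᵥ u) + v ⬝ᵥ (B *ᵥ v) := by
  have hS : (A + B).PosDef := hA.add hB
  have hI : (A⁻¹ + B⁻¹).PosDef := hA.inv.add hB.inv
  have dA := (Matrix.isUnit_iff_isUnit_det _).1 hA.isUnit
  have dB := (Matrix.isUnit_iff_isUnit_det _).1 hB.isUnit
  have dS := (Matrix.isUnit_iff_isUnit_det _).1 hS.isUnit
  have dI := (Matrix.isUnit_iff_isUnit_det _).1 hI.isUnit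
  have sA : Aᵀ = A := by simpa using hA.isHermitian.eq
  have sB : Bᵀ = B := by simpa using hB.isHermitian.eq
  have key : u ⬝ᵥ (A *ᵥ u) + v ⬝ᵥ (B *ᵥ v)
        - (u + v) ⬝ᵥ ((A⁻¹ + B⁻¹)⁻¹ *ᵥ (u + v))
      = (A *ᵥ u - B *ᵥ v) ⬝ᵥ ((A + B)⁻¹ *ᵥ (A *ᵥ u - B *ᵥ v)) := by
    obtain ⟨w, hw⟩ : ∃ w, w = (A + B)⁻¹ *ᵥ (A *ᵥ u - B *ᵥ v) := ⟨_, rfl⟩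
    have h1 : A *ᵥ w + B *ᵥ w = A *ᵥ u - B *ᵥ v := by
      rw [← Matrix.add_mulVec, hw, Matrix.mulVec_mulVec, Matrix.mul_nonsing_inv _ dS,
        Matrix.one_mulVec]
    have h2 : A *ᵥ (u - w) = B *ᵥ (v + w) := by
      rw [Matrix.mulVec_sub, Matrix.mulVec_add, sub_eq_iff_eq_add]
      rw [eq_sub_iff_add_eq] at h1
      rw [← h1]; abel
    have h3 : (A⁻¹ + B⁻¹) *ᵥ (A *ᵥ (u - w)) = u + v := by
      rw [Matrix.add_mulVec]
      nth_rewrite 2 [h2]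
      rw [Matrix.mulVec_mulVec, Matrix.mulVec_mulVec, Matrix.nonsing_inv_mul _ dA,
        Matrix.nonsing_inv_mul _ dB, Matrix.one_mulVec, Matrix.one_mulVec]
      abel
    have h4 : (A⁻¹ + B⁻¹)⁻¹ *ᵥ (u + v) = A *ᵥ (u - w) := by
      rw [← h3, Matrix.mulVec_mulVec, Matrix.nonsing_inv_mul _ dI, Matrix.one_mulVec]
    have h5 : (A *ᵥ u) ⬝ᵥ w = u ⬝ᵥ (A *ᵥ w) := by
      rw [Matrix.dotProduct_mulVec, ← Matrix.mulVec_transpose, sA]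
    have h6 : (B *ᵥ v) ⬝ᵥ w = v ⬝ᵥ (B *ᵥ w) := by
      rw [Matrix.dotProduct_mulVec, ← Matrix.mulVec_transpose, sB]
    rw [← hw, h4, sub_dotProduct, h5, h6, add_dotProduct]
    nth_rewrite 2 [h2]
    rw [Matrix.mulVec_sub, Matrix.mulVec_add, dotProduct_sub, dotProduct_add]
    ring
  refine ⟨key, ?_⟩
  have h := hS.inv.posSemidef.dotProduct_mulVec_nonneg (A *ᵥ u - B *ᵥ v)
  rw [star_trivial] at h
  linarith
end

section
/- Fix reals p ≥ 0 and γ ≥ 0, an integer n ≥ 1, and R > 0. There exists a constant C > 0, depending only on p, γ, n and R, such that for every b ∈ ℝⁿ with ‖b‖₂ ≤ R and every n×n real symmetric positive-definite matrix A: ∫_{ℝⁿ} (∏_{i=1}^n (γ + x_i²)^p) exp(−½(xᵀAx − 2bᵀx)) dx ≤ C · det(A)^{−1/2} · exp(½ bᵀA⁻¹b) · ∏_{i=1}^n ( γ^p + (A⁻¹)_{ii}^p (1 + Σ_{j=1}^n (A⁻¹)_{jj}^p) ). -/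
open Matrix MeasureTheory

lemma aux_add_rpow {a b p : ℝ} (ha : 0 ≤ a) (hb : 0 ≤ b) (hp : 0 ≤ p) :
    (a + b) ^ p ≤ 2 ^ p * (a ^ p + b ^ p) := by
  have h1 : (a + b) ^ p ≤ (2 * max a b) ^ p := by
    apply Real.rpow_le_rpow (by positivity) _ hp
    linarith [le_max_left a b, le_max_right a b]
  rw [Real.mul_rpow (by norm_num) (le_max_of_le_left ha)] at h1
  refine h1.trans (mul_le_mul_of_nonneg_left ?_ (by positivity))
  have := Real.rpow_nonneg ha p
  have := Real.rpow_nonneg hb p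
  rcases max_choice a b with h | h <;> rw [h] <;> linarith

lemma aux_sum_rpow {n : ℕ} (hn : 1 ≤ n) {s : Fin n → ℝ} (hs : ∀ i, 0 ≤ s i) {p : ℝ} (hp : 0 ≤ p) :
    (∑ i, s i) ^ p ≤ (n : ℝ) ^ p * ∑ i, s i ^ p := by
  have : Nonempty (Fin n) := ⟨⟨0, hn⟩⟩
  obtain ⟨k, hk⟩ := Finite.exists_max s
  have h1 : ∑ i, s i ≤ n * s k := by
    calc ∑ i, s i ≤ ∑ _i : Fin n, s k := Finset.sum_le_sum fun i _ => hk i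
      _ = n * s k := by simp
  have h2 := Real.rpow_le_rpow (Finset.sum_nonneg fun i _ => hs i) h1 hp
  rw [Real.mul_rpow (by positivity) (hs k)] at h2
  refine h2.trans (mul_le_mul_of_nonneg_left ?_ (by positivity))
  exact Finset.single_le_sum (f := fun i => s i ^ p)
    (fun i _ => Real.rpow_nonneg (hs i) p) (Finset.mem_univ k)

lemma aux_poly_exp {q : ℝ} (hq : 0 ≤ q) : ∃ M : ℝ, 0 < M ∧ ∀ t : ℝ, 0 ≤ t →
    (1 + t) ^ q ≤ M * Real.exp (1 / 4 * t) := by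
  refine ⟨(4 * (q + 1)) ^ (q + 1) * Real.exp (1 / 4), by positivity, fun t ht => ?_⟩
  have hr : 0 < q + 1 := by linarith
  have h1 : 1 + t ≤ 4 * (q + 1) * Real.exp ((1 + t) / (4 * (q + 1))) := by
    have h := Real.add_one_le_exp ((1 + t) / (4 * (q + 1)))
    have : (1 + t) / (4 * (q + 1)) ≤ Real.exp ((1 + t) / (4 * (q + 1))) := by linarith
    rw [div_le_iff₀ (by positivity)] at this
    linarith
  calc (1 + t) ^ q ≤ (1 + t) ^ (q + 1) :=
        Real.rpow_le_rpow_of_exponent_le (by linarith) (by linarith)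
    _ ≤ (4 * (q + 1) * Real.exp ((1 + t) / (4 * (q + 1)))) ^ (q + 1) :=
        Real.rpow_le_rpow (by linarith) h1 hr.le
    _ = (4 * (q + 1)) ^ (q + 1) * Real.exp (1 / 4) * Real.exp (1 / 4 * t) := by
        rw [Real.mul_rpow (by positivity) (by positivity), ← Real.exp_mul, mul_assoc,
          ← Real.exp_add]
        congr 2
        field_simp

lemma aux_scalar {p γ R c s N T Q u : ℝ} (hp : 0 ≤ p) (hγ : 0 ≤ γ) (hs : 0 ≤ s)
    (hN : 0 ≤ N) (hT : 0 ≤ T) (hQ : 0 ≤ Q) (hc : 0 ≤ c) (hTQ : T ^ p ≤ c * Q) (hu : 0 ≤ u)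
    (hus : u ≤ 2 * s * (R ^ 2 * T + N)) :
    (γ + u) ^ p ≤ 2 ^ p * (1 + 2 ^ p * (2 ^ p * ((R ^ 2) ^ p * c + 1))) * (1 + N) ^ p *
      (γ ^ p + s ^ p * (1 + Q)) := by
  have hW : 0 ≤ R ^ 2 * T + N := by positivity
  set Z := (1 + N) ^ p with hZ
  have hZ1 : 1 ≤ Z := Real.one_le_rpow (by linarith) hp
  have hNZ : N ^ p ≤ Z := Real.rpow_le_rpow hN (by linarith) hp
  have hG : 0 ≤ γ ^ p := Real.rpow_nonneg hγ p
  have hS : 0 ≤ s ^ p := Real.rpow_nonneg hs p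
  have hr : 0 ≤ (R ^ 2) ^ p := by positivity
  have hW2 : (R ^ 2 * T + N) ^ p ≤ 2 ^ p * ((R ^ 2) ^ p * c + 1) * (1 + Q) * Z := by
    calc (R ^ 2 * T + N) ^ p ≤ 2 ^ p * ((R ^ 2 * T) ^ p + N ^ p) :=
          aux_add_rpow (by positivity) hN hp
      _ = 2 ^ p * ((R ^ 2) ^ p * T ^ p + N ^ p) := by
          rw [Real.mul_rpow (by positivity) hT]
      _ ≤ 2 ^ p * ((R ^ 2) ^ p * (c * Q) + Z) := by gcongr
      _ ≤ 2 ^ p * (((R ^ 2) ^ p * c + 1) * (1 + Q) * Z) := by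
          gcongr
          have h1 : 0 ≤ (R ^ 2) ^ p * c := by positivity
          have h2 : (R ^ 2) ^ p * c * Q * 1 ≤ (R ^ 2) ^ p * c * Q * Z := by gcongr
          have h3 : 0 ≤ (R ^ 2) ^ p * c * Z := by positivity
          have h4 : 0 ≤ Q * Z := by positivity
          nlinarith
      _ = _ := by ring
  set D := 2 ^ p * ((R ^ 2) ^ p * c + 1) with hD
  have hD0 : 0 ≤ D := by positivity
  calc (γ + u) ^ p ≤ 2 ^ p * (γ ^ p + u ^ p) := aux_add_rpow hγ hu hp
    _ ≤ 2 ^ p * (γ ^ p + (2 * s * (R ^ 2 * T + N)) ^ p) := by gcongr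
    _ = 2 ^ p * (γ ^ p + 2 ^ p * s ^ p * (R ^ 2 * T + N) ^ p) := by
        rw [Real.mul_rpow (by positivity) hW, Real.mul_rpow (by norm_num) hs]
    _ ≤ 2 ^ p * (γ ^ p + 2 ^ p * s ^ p * (D * (1 + Q) * Z)) := by gcongr
    _ ≤ 2 ^ p * ((1 + 2 ^ p * D) * Z * (γ ^ p + s ^ p * (1 + Q))) := by
        gcongr
        have h1 : 0 ≤ (2 : ℝ) ^ p * D * Z * γ ^ p := by positivity
        have h2 : 0 ≤ Z * (s ^ p * (1 + Q)) := by positivity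
        have h3 : γ ^ p * 1 ≤ γ ^ p * Z := by gcongr
        nlinarith
    _ = _ := by ring

lemma aux_cs {n : ℕ} (f g : Fin n → ℝ) : (f ⬝ᵥ g) ^ 2 ≤ (f ⬝ᵥ f) * (g ⬝ᵥ g) := by
  have := Finset.sum_mul_sq_le_sq_mul_sq Finset.univ f g
  simpa [dotProduct, sq] using this

lemma aux_factor {n : ℕ} {A : Matrix (Fin n) (Fin n) ℝ} (hA : A.PosDef) :
    ∃ B : Matrix (Fin n) (Fin n) ℝ, A = Bᵀ * B := by
  open scoped MatrixOrder in
  obtain ⟨B, hB⟩ := CStarAlgebra.nonneg_iff_eq_star_mul_self.mp hA.posSemidef.nonneg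
  exact ⟨B, by simpa [star_eq_conjTranspose] using hB⟩

lemma aux_gauss_int (n : ℕ) :
    Integrable (fun y : Fin n → ℝ => Real.exp (-(1 / 4) * (y ⬝ᵥ y))) := by
  have h := Integrable.fintype_prod (ι := Fin n)
    (f := fun _ (v : ℝ) => Real.exp (-(1 / 4) * v ^ 2)) (μ := fun _ => volume)
    (fun _ => integrable_exp_neg_mul_sq (by norm_num))
  refine h.congr (Filter.Eventually.of_forall fun y => ?_)
  simp only [← Real.exp_sum, dotProduct, Finset.mul_sum, sq]

lemma aux_change {n : ℕ} (B : Matrix (Fin n) (Fin n) ℝ) (hB : B.det ≠ 0) (m : Fin n → ℝ)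
    {h : (Fin n → ℝ) → ℝ} (hi : Integrable h) :
    Integrable (fun x => h (B *ᵥ (x - m))) ∧
      ∫ x, h (B *ᵥ (x - m)) = |B.det|⁻¹ * ∫ y, h y := by
  have hmap := Real.map_matrix_volume_pi_eq_smul_volume_pi hB
  have hmeas : AEMeasurable (toLin' B) (volume : Measure (Fin n → ℝ)) :=
    (LinearMap.continuous_of_finiteDimensional (toLin' B)).aemeasurable
  have hi2 : Integrable h (Measure.map (toLin' B) volume) := by
    rw [hmap]; exact hi.smul_measure ENNReal.ofReal_ne_top
  have hi3 : Integrable (fun x => h (B *ᵥ x)) := by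
    have := (integrable_map_measure hi2.aestronglyMeasurable hmeas).1 hi2
    simpa [Function.comp_def] using this
  refine ⟨hi3.comp_sub_right m, ?_⟩
  rw [integral_sub_right_eq_self (fun x => h (B *ᵥ x)) m]
  have h2 := integral_map hmeas hi2.aestronglyMeasurable
  simp only [toLin'_apply] at h2
  rw [← h2, hmap, integral_smul_measure, ENNReal.toReal_ofReal (abs_nonneg _), abs_inv, smul_eq_mul]

set_option maxHeartbeats 2000000 in
/-- Gaussian moment bound: for `p, γ ≥ 0`, `n ≥ 1`, `R > 0`, there is `C > 0`
(depending only on `p, γ, n, R`) such that for all `b` with `‖b‖₂ ≤ R` and all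
symmetric positive-definite `A`:
`∫ (∏ᵢ (γ + xᵢ²)^p) exp(−½(xᵀAx − 2bᵀx)) dx
  ≤ C · det(A)^{−1/2} · exp(½ bᵀA⁻¹b) · ∏ᵢ (γ^p + (A⁻¹)ᵢᵢ^p (1 + Σⱼ (A⁻¹)ⱼⱼ^p))`. -/
theorem stmt2 {n : ℕ} (hn : 1 ≤ n) (p γ R : ℝ) (hp : 0 ≤ p) (hγ : 0 ≤ γ) (hR : 0 < R) :
    ∃ C : ℝ, 0 < C ∧
      ∀ (b : Fin n → ℝ), Real.sqrt (∑ i, b i ^ 2) ≤ R →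
      ∀ (A : Matrix (Fin n) (Fin n) ℝ), A.PosDef →
        (∫ x : Fin n → ℝ,
            (∏ i, (γ + x i ^ 2) ^ p) *
              Real.exp (-(1/2) * (x ⬝ᵥ (A *ᵥ x) - 2 * (b ⬝ᵥ x))))
          ≤ C * A.det ^ (-(1/2) : ℝ) * Real.exp ((1/2) * (b ⬝ᵥ (A⁻¹ *ᵥ b))) *
              ∏ i, (γ ^ p + (A⁻¹ i i) ^ p * (1 + ∑ j, (A⁻¹ j j) ^ p)) := by
  obtain ⟨M, hM, hMb⟩ := aux_poly_exp (q := p * n) (by positivity)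
  set K : ℝ := 2 ^ p * (1 + 2 ^ p * (2 ^ p * ((R ^ 2) ^ p * (n : ℝ) ^ p + 1))) with hK
  have hKpos : 0 < K := by positivity
  set J : ℝ := ∫ y : Fin n → ℝ, Real.exp (-(1 / 4) * (y ⬝ᵥ y)) with hJ
  have hJ0 : 0 ≤ J := integral_nonneg fun _ => (Real.exp_pos _).le
  refine ⟨K ^ n * M * (J + 1), by positivity, ?_⟩
  intro b hb A hA
  have hbR : b ⬝ᵥ b ≤ R ^ 2 := by
    have := (Real.sqrt_le_left hR.le).1 hb
    simpa [dotProduct, sq] using this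
  obtain ⟨B, hAB⟩ := aux_factor hA
  have hAdet : 0 < A.det := hA.det_pos
  have hdet : A.det = B.det ^ 2 := by rw [hAB, det_mul, det_transpose, sq]
  have hB0 : B.det ≠ 0 := by
    intro h; rw [hdet, h] at hAdet; norm_num at hAdet
  have hBu : IsUnit B.det := isUnit_iff_ne_zero.2 hB0
  have hAu : IsUnit A.det := isUnit_iff_ne_zero.2 hAdet.ne'
  set S := B⁻¹ with hS
  have hSS : A⁻¹ = S * Sᵀ := by
    rw [hAB, Matrix.mul_inv_rev, hS, transpose_nonsing_inv]
  have hdiag : ∀ i, A⁻¹ i i = S i ⬝ᵥ S i := by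
    intro i; rw [hSS, Matrix.mul_apply]; rfl
  have hs0 : ∀ i, 0 ≤ A⁻¹ i i := fun i => by
    rw [hdiag]; exact Finset.sum_nonneg fun j _ => mul_self_nonneg _
  set m := A⁻¹ *ᵥ b with hm
  set T := ∑ j, A⁻¹ j j with hT
  set Q := ∑ j, (A⁻¹ j j) ^ p with hQ
  have hT0 : 0 ≤ T := Finset.sum_nonneg fun j _ => hs0 j
  have hQ0 : 0 ≤ Q := Finset.sum_nonneg fun j _ => Real.rpow_nonneg (hs0 j) p
  have hTQ : T ^ p ≤ (n : ℝ) ^ p * Q := aux_sum_rpow hn hs0 hp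
  -- the shifted mean
  have hw : (Sᵀ *ᵥ b) ⬝ᵥ (Sᵀ *ᵥ b) ≤ R ^ 2 * T := by
    have hTT : T = ∑ j, Sᵀ j ⬝ᵥ Sᵀ j := by
      rw [hT]
      simp only [hdiag, dotProduct, transpose_apply]
      exact Finset.sum_comm
    have h1 : (Sᵀ *ᵥ b) ⬝ᵥ (Sᵀ *ᵥ b) = ∑ j, (Sᵀ j ⬝ᵥ b) ^ 2 := by
      simp only [sq]; rfl
    rw [h1, hTT, Finset.mul_sum]
    refine Finset.sum_le_sum fun j _ => ?_
    refine (aux_cs _ _).trans ?_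
    rw [mul_comm]
    exact mul_le_mul_of_nonneg_right hbR (Finset.sum_nonneg fun j _ => mul_self_nonneg _)
  have hmi : ∀ i, m i ^ 2 ≤ A⁻¹ i i * (R ^ 2 * T) := by
    intro i
    have h1 : m i = S i ⬝ᵥ (Sᵀ *ᵥ b) := by
      rw [hm, hSS, ← mulVec_mulVec]; rfl
    rw [h1]
    refine (aux_cs _ _).trans ?_
    rw [← hdiag]
    exact mul_le_mul_of_nonneg_left hw (hs0 i)
  have hxi : ∀ (x : Fin n → ℝ) i, x i ^ 2 ≤
      2 * A⁻¹ i i * (R ^ 2 * T + (B *ᵥ (x - m)) ⬝ᵥ (B *ᵥ (x - m))) := by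
    intro x i
    have h1 : x i - m i = S i ⬝ᵥ (B *ᵥ (x - m)) := by
      have : S *ᵥ (B *ᵥ (x - m)) = x - m := by
        rw [mulVec_mulVec, hS, nonsing_inv_mul _ hBu, one_mulVec]
      exact (congrFun this i).symm
    have h2 := aux_cs (S i) (B *ᵥ (x - m))
    rw [← h1, ← hdiag] at h2
    have h3 := hmi i
    nlinarith [sq_nonneg (x i - 2 * m i)]
  have hexp : ∀ x : Fin n → ℝ, x ⬝ᵥ (A *ᵥ x) - 2 * (b ⬝ᵥ x) =
      (B *ᵥ (x - m)) ⬝ᵥ (B *ᵥ (x - m)) - b ⬝ᵥ m := by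
    intro x
    have hAm : A *ᵥ m = b := by
      rw [hm, mulVec_mulVec, mul_nonsing_inv _ hAu, one_mulVec]
    have hsymm : ∀ u v : Fin n → ℝ, (B *ᵥ u) ⬝ᵥ (B *ᵥ v) = u ⬝ᵥ (A *ᵥ v) := by
      intro u v
      rw [hAB, ← mulVec_mulVec, dotProduct_mulVec u, vecMul_transpose]
    have h1 : m ⬝ᵥ (A *ᵥ x) = b ⬝ᵥ x := by
      rw [← hsymm, dotProduct_comm, hsymm, hAm, dotProduct_comm]
    rw [hsymm, mulVec_sub, hAm, sub_dotProduct, dotProduct_sub, dotProduct_sub, h1,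
      dotProduct_comm x b, dotProduct_comm m b]
    ring
  set P := ∏ i, (γ ^ p + (A⁻¹ i i) ^ p * (1 + Q)) with hP
  have hP0 : 0 ≤ P := Finset.prod_nonneg fun i _ => by
    have := Real.rpow_nonneg (hs0 i) p
    positivity
  set E := Real.exp (1 / 2 * (b ⬝ᵥ m)) with hE
  obtain ⟨hgi, hgv⟩ := aux_change B hB0 m (aux_gauss_int n)
  have hbound : ∀ x : Fin n → ℝ, (∏ i, (γ + x i ^ 2) ^ p) *
      Real.exp (-(1/2) * (x ⬝ᵥ (A *ᵥ x) - 2 * (b ⬝ᵥ x))) ≤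
      K ^ n * M * E * P * Real.exp (-(1 / 4) * ((B *ᵥ (x - m)) ⬝ᵥ (B *ᵥ (x - m)))) := by
    intro x
    rw [hexp]
    set N := (B *ᵥ (x - m)) ⬝ᵥ (B *ᵥ (x - m)) with hN
    have hN0 : 0 ≤ N := Finset.sum_nonneg fun j _ => mul_self_nonneg _
    have h1 : ∏ i, (γ + x i ^ 2) ^ p ≤
        ∏ i, (K * (1 + N) ^ p * (γ ^ p + (A⁻¹ i i) ^ p * (1 + Q))) := by
      refine Finset.prod_le_prod (fun i _ => by positivity) fun i _ => ?_
      exact aux_scalar hp hγ (hs0 i) hN0 hT0 hQ0 (by positivity) hTQ (sq_nonneg _) (hxi x i)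
    rw [Finset.prod_mul_distrib, ← hP, Finset.prod_const, Finset.card_univ, Fintype.card_fin,
      mul_pow, ← Real.rpow_natCast ((1 + N) ^ p) n, ← Real.rpow_mul (by linarith)] at h1
    have h2 := hMb N hN0
    have h3 : Real.exp (-(1/2) * (N - b ⬝ᵥ m)) =
        E * Real.exp (-(1/4) * N) * Real.exp (-(1/4) * N) := by
      rw [hE, ← Real.exp_add, ← Real.exp_add]; congr 1; ring
    have h4 : Real.exp (1/4 * N) * Real.exp (-(1/4) * N) = 1 := by
      rw [← Real.exp_add]; simp
    calc _ ≤ K ^ n * (M * Real.exp (1/4 * N)) * P *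
          (E * Real.exp (-(1/4) * N) * Real.exp (-(1/4) * N)) := by
          rw [h3]
          refine mul_le_mul_of_nonneg_right (h1.trans ?_) (by positivity)
          gcongr
      _ = K ^ n * M * E * P * Real.exp (-(1/4) * N) *
          (Real.exp (1/4 * N) * Real.exp (-(1/4) * N)) := by ring
      _ = _ := by rw [h4, mul_one]
  have hdetpow : A.det ^ (-(1/2) : ℝ) = |B.det|⁻¹ := by
    rw [Real.rpow_neg hAdet.le, ← Real.sqrt_eq_rpow, hdet, Real.sqrt_sq_eq_abs]
  have hfin := integral_mono_of_nonneg (μ := (volume : Measure (Fin n → ℝ)))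
    (Filter.Eventually.of_forall fun x => by
      have : 0 ≤ ∏ i, (γ + x i ^ 2) ^ p := Finset.prod_nonneg fun i _ => by positivity
      exact mul_nonneg this (Real.exp_pos _).le)
    (hgi.const_mul (K ^ n * M * E * P)) (Filter.Eventually.of_forall hbound)
  refine hfin.trans ?_
  rw [integral_const_mul, hgv, hdetpow, ← hJ]
  have : 0 ≤ K ^ n * M * E * P * |B.det|⁻¹ := by positivity
  nlinarith
end

section
/- Let α > 0 and δ ∈ (0, α). Then (Γ(α + 1/2 − δ) / Γ(α + 1/2)) · (Γ(δ + 1/2) / √π) < 1. -/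
theorem weak_Gamma_ineq (a d e : ℝ) (ha : 0 < a) (hd : 0 < d) (he : 0 < e) :
    Real.Gamma (a + d) * Real.Gamma (a + e) ≤ Real.Gamma a * Real.Gamma (a + d + e) := by
  have hc := Real.convexOn_log_Gamma
  have h1 := hc.2 (Set.mem_Ioi.2 ha) (Set.mem_Ioi.2 (show (0:ℝ) < a + d + e by positivity))
    (show 0 ≤ e / (d + e) by positivity) (show 0 ≤ d / (d + e) by positivity) (by field_simp; ring)
  have h2 := hc.2 (Set.mem_Ioi.2 ha) (Set.mem_Ioi.2 (show (0:ℝ) < a + d + e by positivity))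
    (show 0 ≤ d / (d + e) by positivity) (show 0 ≤ e / (d + e) by positivity) (by field_simp)
  simp only [smul_eq_mul, Function.comp] at h1 h2
  rw [show e / (d + e) * a + d / (d + e) * (a + d + e) = a + d by field_simp; ring] at h1
  rw [show d / (d + e) * a + e / (d + e) * (a + d + e) = a + e by field_simp; ring] at h2
  have p1 := Real.Gamma_pos_of_pos (show 0 < a + d by positivity)
  have p2 := Real.Gamma_pos_of_pos (show 0 < a + e by positivity)
  have p3 := Real.Gamma_pos_of_pos ha
  have p4 := Real.Gamma_pos_of_pos (show 0 < a + d + e by positivity)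
  rw [← Real.log_le_log_iff (by positivity) (by positivity), Real.log_mul p1.ne' p2.ne',
    Real.log_mul p3.ne' p4.ne']
  refine (add_le_add h1 h2).trans (le_of_eq ?_)
  field_simp
  ring

/-- For `α > 0` and `δ ∈ (0, α)`:
`(Γ(α + 1/2 − δ)/Γ(α + 1/2)) · (Γ(δ + 1/2)/√π) < 1`. -/
theorem stmt3 (α δ : ℝ) (hα : 0 < α) (hδ : δ ∈ Set.Ioo 0 α) :
    (Real.Gamma (α + 1/2 - δ) / Real.Gamma (α + 1/2)) *
      (Real.Gamma (δ + 1/2) / Real.sqrt Real.pi) < 1 := by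
  obtain ⟨h0, h1⟩ := hδ
  have hw := weak_Gamma_ineq (1/2 + 1) δ (α - δ) (by norm_num) h0 (by linarith)
  rw [show (1/2 + 1 + δ : ℝ) = (δ + 1/2) + 1 by ring,
    show (1/2 + 1 + (α - δ) : ℝ) = (α + 1/2 - δ) + 1 by ring,
    show (δ + 1/2 + 1 + (α - δ) : ℝ) = (α + 1/2) + 1 by ring,
    Real.Gamma_add_one (by linarith), Real.Gamma_add_one (by linarith),
    Real.Gamma_add_one (by norm_num), Real.Gamma_add_one (by linarith),
    Real.Gamma_one_half_eq] at hw
  have p1 := Real.Gamma_pos_of_pos (show 0 < δ + 1/2 by linarith)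
  have p2 := Real.Gamma_pos_of_pos (show 0 < α + 1/2 - δ by linarith)
  have p4 := Real.Gamma_pos_of_pos (show 0 < α + 1/2 by linarith)
  have p3 : 0 < Real.sqrt Real.pi := Real.sqrt_pos.2 Real.pi_pos
  rw [div_mul_div_comm, div_lt_one (by positivity)]
  by_contra! hcon
  have hk : 1/2 * (α + 1/2) < (δ + 1/2) * (α + 1/2 - δ) := by nlinarith
  have q : 0 < Real.Gamma (α + 1/2 - δ) * Real.Gamma (δ + 1/2) := by positivity
  have s1 := mul_lt_mul_of_pos_right hk q
  have s2 := mul_le_mul_of_nonneg_left hcon (show 0 ≤ 1/2 * (α + 1/2) by positivity)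
  nlinarith
end

section
/- Let ρ > 0, let B be a real m×n matrix, and let m̄ ∈ ℝⁿ lie in the range of Bᵀ. Then there exists a finite constant C such that for all V = (V₁,…,Vₙ) ∈ (0,∞)ⁿ, with D_V = diag(V₁,…,Vₙ), one has ‖(ρBᵀB + D_V⁻¹)⁻¹ m̄‖₂ ≤ C. -/
open Matrix

/-- On a closed sign cone meeting `ker B` trivially, `B` is bounded below. -/
lemma cone_bound {m n : ℕ} (B : Matrix (Fin m) (Fin n) ℝ) (σ : Fin n → SignType) :
    ∃ c : ℝ, 0 < c ∧
      ((∀ k : Fin n → ℝ, (∀ i, 0 ≤ (σ i : ℝ) * k i ∧ (σ i = 0 → k i = 0)) →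
        B *ᵥ k = 0 → k = 0) →
      ∀ x : Fin n → ℝ, (∀ i, 0 ≤ (σ i : ℝ) * x i ∧ (σ i = 0 → x i = 0)) →
        c * ‖x‖ ^ 2 ≤ (B *ᵥ x) ⬝ᵥ (B *ᵥ x)) := by
  by_cases h : (∀ k : Fin n → ℝ, (∀ i, 0 ≤ (σ i : ℝ) * k i ∧ (σ i = 0 → k i = 0)) →
        B *ᵥ k = 0 → k = 0)
  swap
  · exact ⟨1, one_pos, fun h' => absurd h' h⟩
  set K : Set (Fin n → ℝ) := {k | ∀ i, 0 ≤ (σ i : ℝ) * k i ∧ (σ i = 0 → k i = 0)} with hK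
  have hcl : IsClosed K := by
    have : K = ⋂ i, ({k | 0 ≤ (σ i : ℝ) * k i} ∩ {k | σ i = 0 → k i = 0}) := by
      ext k; simp [hK]
    rw [this]
    refine isClosed_iInter fun i => IsClosed.inter ?_ ?_
    · exact isClosed_le continuous_const (by fun_prop)
    · by_cases h0 : σ i = 0
      · simpa [h0] using isClosed_eq (continuous_apply i) continuous_const
      · simp [h0]
  have hcomp : IsCompact (Metric.sphere (0 : Fin n → ℝ) 1 ∩ K) :=
    (isCompact_sphere _ _).inter_right hcl
  have hcont : Continuous fun x : Fin n → ℝ => (B *ᵥ x) ⬝ᵥ (B *ᵥ x) := by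
    fun_prop
  have hunit : ∀ x ∈ K, x ≠ 0 → (‖x‖⁻¹ • x) ∈ Metric.sphere (0 : Fin n → ℝ) 1 ∩ K := by
    intro x hx hx0
    have hn : 0 < ‖x‖ := norm_pos_iff.2 hx0
    refine ⟨?_, fun i => ⟨?_, fun h0 => ?_⟩⟩
    · simp [norm_smul, hn.ne']
    · have := mul_nonneg (inv_pos.2 hn).le (hx i).1
      simp only [Pi.smul_apply, smul_eq_mul]
      linarith
    · simp [(hx i).2 h0]
  rcases (Metric.sphere (0 : Fin n → ℝ) 1 ∩ K).eq_empty_or_nonempty with he | hne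
  · refine ⟨1, one_pos, fun _ x hx => ?_⟩
    have : x = 0 := by
      by_contra h0
      have := hunit x hx h0
      rw [he] at this
      exact this
    simp [this]
  · obtain ⟨u, hu, hmin⟩ := hcomp.exists_isMinOn hne hcont.continuousOn
    have hu0 : u ≠ 0 := by
      rintro rfl
      simpa using hu.1
    have hpos : 0 < (B *ᵥ u) ⬝ᵥ (B *ᵥ u) := by
      refine lt_of_le_of_ne (Finset.sum_nonneg fun i _ => mul_self_nonneg _) fun h0 => ?_
      exact hu0 (h u hu.2 (dotProduct_self_eq_zero.1 h0.symm))
    refine ⟨_, hpos, fun _ x hx => ?_⟩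
    by_cases hx0 : x = 0
    · simp [hx0]
    have hn : 0 < ‖x‖ := norm_pos_iff.2 hx0
    have h1 := hmin (hunit x hx hx0)
    simp only [Set.mem_setOf_eq, mulVec_smul, smul_dotProduct, dotProduct_smul,
      smul_eq_mul] at h1
    calc _ ≤ (‖x‖⁻¹ * (‖x‖⁻¹ * ((B *ᵥ x) ⬝ᵥ (B *ᵥ x)))) * ‖x‖ ^ 2 := by gcongr
      _ = _ := by field_simp

/-- Uniform boundedness: for `ρ > 0`, an `m×n` matrix `B`, and `m̄ ∈ Range(Bᵀ)`,
there is a finite constant `C` such that for all `V ∈ (0,∞)ⁿ`,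
`‖(ρBᵀB + D_V⁻¹)⁻¹ m̄‖₂ ≤ C`. -/
theorem stmt4 {m n : ℕ} (ρ : ℝ) (hρ : 0 < ρ) (B : Matrix (Fin m) (Fin n) ℝ)
    (mbar : Fin n → ℝ) (hmbar : ∃ y : Fin m → ℝ, mbar = Bᵀ *ᵥ y) :
    ∃ C : ℝ, ∀ V : Fin n → ℝ, (∀ i, 0 < V i) →
      Real.sqrt (∑ i,
          (((ρ • (Bᵀ * B) + Matrix.diagonal (fun i => (V i)⁻¹))⁻¹ *ᵥ mbar) i) ^ 2)
        ≤ C := by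
  obtain ⟨y, rfl⟩ := hmbar
  choose c hc hcb using cone_bound B
  have hyy : 0 ≤ y ⬝ᵥ y := Finset.sum_nonneg fun i _ => mul_self_nonneg _
  have hterm : ∀ σ, 0 ≤ (y ⬝ᵥ y) / ρ ^ 2 / c σ := fun σ => by
    have := hc σ
    positivity
  refine ⟨Real.sqrt (n * ∑ σ, (y ⬝ᵥ y) / ρ ^ 2 / c σ), fun V hV => Real.sqrt_le_sqrt ?_⟩
  set A := ρ • (Bᵀ * B) + Matrix.diagonal (fun i => (V i)⁻¹) with hA
  set x := A⁻¹ *ᵥ (Bᵀ *ᵥ y) with hx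
  have hsum : ∑ i, x i ^ 2 ≤ n * ‖x‖ ^ 2 := by
    calc ∑ i, x i ^ 2 ≤ ∑ _i : Fin n, ‖x‖ ^ 2 := by
          refine Finset.sum_le_sum fun i _ => ?_
          rw [← sq_abs]
          have := norm_le_pi_norm x i
          rw [Real.norm_eq_abs] at this
          gcongr
      _ = _ := by simp
  refine hsum.trans (mul_le_mul_of_nonneg_left ?_ (Nat.cast_nonneg n))
  by_cases hdet : IsUnit A.det
  swap
  · have : x = 0 := by rw [hx, nonsing_inv_apply_not_isUnit A hdet, zero_mulVec]
    rw [this]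
    simpa using Finset.sum_nonneg fun σ _ => hterm σ
  have hAx : A *ᵥ x = Bᵀ *ᵥ y := by
    rw [hx, mulVec_mulVec, mul_nonsing_inv A hdet, one_mulVec]
  -- weak form of the equation
  have hweak : ∀ k : Fin n → ℝ,
      ρ * ((B *ᵥ k) ⬝ᵥ (B *ᵥ x)) + ∑ i, (V i)⁻¹ * (k i * x i) = (B *ᵥ k) ⬝ᵥ y := by
    intro k
    have h1 : k ⬝ᵥ (A *ᵥ x) = k ⬝ᵥ (Bᵀ *ᵥ y) := by rw [hAx]
    have hT : ∀ z : Fin m → ℝ, k ⬝ᵥ (Bᵀ *ᵥ z) = (B *ᵥ k) ⬝ᵥ z := fun z => by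
      rw [dotProduct_mulVec, vecMul_transpose]
    rw [hT, hA, add_mulVec, smul_mulVec, ← mulVec_mulVec, dotProduct_add,
      dotProduct_smul, hT, smul_eq_mul] at h1
    rw [← h1]
    congr 1
    refine Finset.sum_congr rfl fun i _ => ?_
    rw [mulVec_diagonal]
    ring
  have hBx : (B *ᵥ x) ⬝ᵥ (B *ᵥ x) ≤ (y ⬝ᵥ y) / ρ ^ 2 := by
    have h1 := hweak x
    have h2 : 0 ≤ ∑ i, (V i)⁻¹ * (x i * x i) := Finset.sum_nonneg fun i _ =>
      mul_nonneg (inv_pos.2 (hV i)).le (mul_self_nonneg _)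
    have h3 : 0 ≤ (ρ • (B *ᵥ x) - y) ⬝ᵥ (ρ • (B *ᵥ x) - y) :=
      Finset.sum_nonneg fun i _ => mul_self_nonneg _
    simp only [sub_dotProduct, dotProduct_sub, smul_dotProduct, dotProduct_smul,
      smul_eq_mul] at h3
    rw [dotProduct_comm y (B *ᵥ x)] at h3
    rw [le_div_iff₀ (by positivity)]
    nlinarith [mul_nonneg hρ.le h2]
  have hsign : ∀ a : ℝ, (SignType.sign a : ℝ) * |a| = a := fun a => sign_mul_abs a
  have hfin := hcb (fun i => SignType.sign (x i)) (by
    intro k hk hBk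
    have h1 := hweak k
    rw [hBk, zero_dotProduct, zero_dotProduct, mul_zero, zero_add] at h1
    have hnn : ∀ i, 0 ≤ k i * x i := fun i => by
      have := mul_nonneg (hk i).1 (abs_nonneg (x i))
      calc 0 ≤ _ := this
        _ = k i * ((SignType.sign (x i) : ℝ) * |x i|) := by ring
        _ = _ := by rw [hsign]
    rw [Finset.sum_eq_zero_iff_of_nonneg
      (fun i _ => mul_nonneg (inv_pos.2 (hV i)).le (hnn i))] at h1
    funext i
    have h2 := h1 i (Finset.mem_univ i)
    rcases mul_eq_zero.1 h2 with h | h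
    · exact absurd h (inv_pos.2 (hV i)).ne'
    rcases mul_eq_zero.1 h with h | h
    · exact h
    · exact (hk i).2 (by simp [h])) x (fun i => ⟨by
        rw [sign_mul_self]; exact abs_nonneg _, fun h => sign_eq_zero_iff.1 h⟩)
  calc ‖x‖ ^ 2 ≤ (y ⬝ᵥ y) / ρ ^ 2 / c (fun i => SignType.sign (x i)) := by
        rw [le_div_iff₀ (hc _)]
        linarith
    _ ≤ _ := Finset.single_le_sum (f := fun σ => (y ⬝ᵥ y) / ρ ^ 2 / c σ)
        (fun σ _ => hterm σ) (Finset.mem_univ _)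
end

section
/- Let 0 < δ < 1, η ∈ ℝ and s > 0, and define κ(δ) := π^{−1/2} 2^{−δ/2} Γ((1−δ)/2). Then ∫_ℝ |x|^{−δ} (2πs²)^{−1/2} exp(−(x−η)²/(2s²)) dx ≤ κ(δ) s^{−δ}. -/
open MeasureTheory

lemma aux_rearr (δ η b : ℝ) (hδ0 : 0 < δ) (hδ1 : δ < 1) (hb : 0 < b)
    (hi : Integrable fun x : ℝ => |x| ^ (-δ) * Real.exp (-b * x ^ 2)) :
    (∫ x : ℝ, |x| ^ (-δ) * Real.exp (-b * (x - η) ^ 2)) ≤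
      ∫ x : ℝ, |x| ^ (-δ) * Real.exp (-b * x ^ 2) := by
  by_cases h2 : Integrable fun x : ℝ => |x| ^ (-δ) * Real.exp (-b * (x - η) ^ 2)
  swap
  · rw [integral_undef h2]
    exact integral_nonneg fun x => by positivity
  have h1' := hi.comp_sub_left η
  have h2' := h2.comp_sub_left η
  have e1 := integral_sub_left_eq_self
    (fun x : ℝ => |x| ^ (-δ) * Real.exp (-b * x ^ 2)) volume η
  have e2 := integral_sub_left_eq_self
    (fun x : ℝ => |x| ^ (-δ) * Real.exp (-b * (x - η) ^ 2)) volume η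
  have key := integral_mono_ae (h2.add h2') (hi.add h1') (by
    have n0 : ∀ᵐ x : ℝ, x ≠ 0 := by
      simp [ae_iff]
    have n1 : ∀ᵐ x : ℝ, x ≠ η := by
      simp [ae_iff]
    filter_upwards [n0, n1] with x hx0 hx1
    have p0 : 0 < |x| := abs_pos.mpr hx0
    have p1 : 0 < |η - x| := abs_pos.mpr (sub_ne_zero.mpr (Ne.symm hx1))
    have r1 : (η - x - η) ^ 2 = x ^ 2 := by ring
    have r2 : (x - η) ^ 2 = (η - x) ^ 2 := by ring
    simp only [Pi.add_apply, r1, r2]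
    rcases le_total |x| |η - x| with h | h
    · have a1 : |η - x| ^ (-δ) ≤ |x| ^ (-δ) :=
        Real.rpow_le_rpow_of_nonpos p0 h (by linarith)
      have a2 : Real.exp (-b * (η - x) ^ 2) ≤ Real.exp (-b * x ^ 2) := by
        apply Real.exp_le_exp.mpr
        nlinarith [sq_le_sq.mpr h]
      nlinarith [mul_nonneg (sub_nonneg.mpr a1) (sub_nonneg.mpr a2)]
    · have a1 : |x| ^ (-δ) ≤ |η - x| ^ (-δ) :=
        Real.rpow_le_rpow_of_nonpos p1 h (by linarith)
      have a2 : Real.exp (-b * x ^ 2) ≤ Real.exp (-b * (η - x) ^ 2) := by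
        apply Real.exp_le_exp.mpr
        nlinarith [sq_le_sq.mpr h]
      nlinarith [mul_nonneg (sub_nonneg.mpr a1) (sub_nonneg.mpr a2)])
  simp only [Pi.add_apply] at key
  rw [integral_add h2 h2', integral_add hi h1'] at key
  linarith

lemma aux_val (δ b : ℝ) (hδ1 : δ < 1) (hb : 0 < b) :
    (∫ x : ℝ, |x| ^ (-δ) * Real.exp (-b * x ^ 2)) =
      b ^ (-(1 - δ) / 2) * Real.Gamma ((1 - δ) / 2) := by
  have h := integral_rpow_mul_exp_neg_mul_rpow (p := 2) (q := -δ) (b := b)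
    (by norm_num) (by linarith) hb
  have h' := integral_comp_abs (f := fun x : ℝ => x ^ (-δ) * Real.exp (-b * x ^ (2 : ℝ)))
  rw [h] at h'
  simp only [Real.rpow_two, sq_abs] at h'
  rw [h', show -(-δ + 1) / 2 = -(1 - δ) / 2 by ring, show (-δ + 1) / 2 = (1 - δ) / 2 by ring]
  ring

lemma aux_int (δ b : ℝ) (hδ1 : δ < 1) (hb : 0 < b) :
    Integrable fun x : ℝ => |x| ^ (-δ) * Real.exp (-b * x ^ 2) := by
  by_contra hn
  have h := aux_val δ b hδ1 hb
  rw [integral_undef hn] at h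
  have : 0 < b ^ (-(1 - δ) / 2) * Real.Gamma ((1 - δ) / 2) :=
    mul_pos (Real.rpow_pos_of_pos hb _) (Real.Gamma_pos_of_pos (by linarith))
  linarith

/-- Negative-moment Gaussian bound: for `0 < δ < 1`, `η ∈ ℝ`, `s > 0`, with
`κ(δ) := π^{−1/2} 2^{−δ/2} Γ((1−δ)/2)`,
`∫ |x|^{−δ} (2πs²)^{−1/2} exp(−(x−η)²/(2s²)) dx ≤ κ(δ) s^{−δ}`. -/
theorem stmt7 (δ η s : ℝ) (hδ0 : 0 < δ) (hδ1 : δ < 1) (hs : 0 < s) :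
    (∫ x : ℝ, |x| ^ (-δ) *
        ((2 * Real.pi * s ^ 2) ^ (-(1/2) : ℝ) * Real.exp (-(x - η) ^ 2 / (2 * s ^ 2))))
      ≤ (Real.pi ^ (-(1/2) : ℝ) * 2 ^ (-δ/2) * Real.Gamma ((1 - δ)/2)) * s ^ (-δ) := by
  have hb : 0 < (2 * s ^ 2)⁻¹ := by positivity
  have h := aux_rearr δ η _ hδ0 hδ1 hb (aux_int δ _ hδ1 hb)
  rw [aux_val δ _ hδ1 hb] at h
  have e : ∀ x : ℝ, |x| ^ (-δ) *
        ((2 * Real.pi * s ^ 2) ^ (-(1/2) : ℝ) * Real.exp (-(x - η) ^ 2 / (2 * s ^ 2))) =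
      (2 * Real.pi * s ^ 2) ^ (-(1/2) : ℝ) *
        (|x| ^ (-δ) * Real.exp (-(2 * s ^ 2)⁻¹ * (x - η) ^ 2)) := by
    intro x
    rw [show -(x - η) ^ 2 / (2 * s ^ 2) = -(2 * s ^ 2)⁻¹ * (x - η) ^ 2 by
      rw [div_eq_mul_inv]; ring]
    ring
  simp only [e]
  rw [integral_const_mul]
  refine (mul_le_mul_of_nonneg_left h (by positivity)).trans (le_of_eq ?_)
  have c : (2 * Real.pi * s ^ 2) ^ (-(1/2) : ℝ) * ((2 * s ^ 2)⁻¹) ^ (-(1 - δ) / 2) =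
      Real.pi ^ (-(1/2) : ℝ) * 2 ^ (-δ/2) * s ^ (-δ) := by
    have hp := Real.pi_pos
    rw [Real.inv_rpow (by positivity), ← Real.rpow_neg (by positivity),
      show 2 * Real.pi * s ^ 2 = Real.pi * (2 * s ^ 2) by ring,
      Real.mul_rpow hp.le (by positivity), mul_assoc, ← Real.rpow_add (by positivity),
      show -(1 / 2) + -(-(1 - δ) / 2) = -δ / 2 by ring,
      Real.mul_rpow (by norm_num) (by positivity), ← Real.rpow_natCast s 2,
      ← Real.rpow_mul hs.le, show ((2 : ℕ) : ℝ) * (-δ / 2) = -δ by push_cast; ring]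
    ring
  rw [← mul_assoc, c]
  ring
end

section
/- Let σ > 0, ã > 0 and p > 0. Define δ(p) := p if 0 < p ≤ 1/2, and δ(p) := min{1/2, 2p−1} if p > 1/2 (so 0 < δ(p) ≤ 1/2), and let κ(δ) := π^{−1/2} 2^{−δ/2} Γ((1−δ)/2). Then there exist constants C₁ > 0 (depending only on p) and C₂ ∈ ℝ (depending on p and ã) such that C₁ · κ(δ(p)) < 1 and, for every M ∈ ℝ with M ≠ 0, E_{GIG(p−1/2, ã, (M/σ)²)}[v^{−δ(p)/2}] ≤ C₁ |M/σ|^{−δ(p)} + C₂. -/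
open MeasureTheory

/-- The GIG expectation `E_{GIG(λ,ψ,χ)}[g]`, defined as the ratio of integrals
`(∫₀^∞ g(v) v^{λ−1} e^{−(ψv + χ/v)/2} dv) / (∫₀^∞ v^{λ−1} e^{−(ψv + χ/v)/2} dv)`. -/
noncomputable def gigExp (lam ψ χ : ℝ) (g : ℝ → ℝ) : ℝ :=
  (∫ v in Set.Ioi (0:ℝ), g v * v ^ (lam - 1) * Real.exp (-(ψ * v + χ / v) / 2)) /
  (∫ v in Set.Ioi (0:ℝ), v ^ (lam - 1) * Real.exp (-(ψ * v + χ / v) / 2))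

/-- `δ(p) := p` for `0 < p ≤ 1/2`, and `δ(p) := min{1/2, 2p−1}` for `p > 1/2`. -/
noncomputable def deltaP (p : ℝ) : ℝ := if p ≤ 1/2 then p else min (1/2) (2 * p - 1)

/-- `κ(δ) := π^{−1/2} 2^{−δ/2} Γ((1−δ)/2)`. -/
noncomputable def kappa (δ : ℝ) : ℝ :=
  Real.pi ^ (-(1/2) : ℝ) * 2 ^ (-δ/2) * Real.Gamma ((1 - δ)/2)

/-- normalised integrand -/
noncomputable def gigW (r b u : ℝ) : ℝ := u ^ r * Real.exp (-(b * u + 1 / u) / 2)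

noncomputable def gigJ (r b : ℝ) : ℝ := ∫ u in Set.Ioi (0:ℝ), gigW r b u

lemma gigW_pos (r b u : ℝ) (hu : 0 < u) : 0 < gigW r b u := by
  unfold gigW; positivity

lemma gigW_cont (r b : ℝ) : ContinuousOn (gigW r b) (Set.Ioi 0) := by
  unfold gigW
  intro u hu
  have hu' : u ≠ 0 := ne_of_gt hu
  apply ContinuousAt.continuousWithinAt
  have : ContinuousAt (fun u : ℝ => u ^ r) u := Real.continuousAt_rpow_const u r (Or.inl hu')
  fun_prop (disch := assumption)

lemma gigW_meas (r b : ℝ) :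
    AEStronglyMeasurable (gigW r b) (volume.restrict (Set.Ioi 0)) :=
  (gigW_cont r b).aestronglyMeasurable measurableSet_Ioi

lemma gigW_int (r b : ℝ) (hb : 0 < b) : IntegrableOn (gigW r b) (Set.Ioi 0) := by
  obtain ⟨k, hk⟩ := exists_nat_gt (-r - 1)
  have hg : IntegrableOn (fun u : ℝ => (k.factorial * 2 ^ k : ℝ) *
      (u ^ (r + k) * Real.exp (-(b/2) * u ^ (1:ℝ)))) (Set.Ioi 0) := by
    apply Integrable.const_mul
    exact integrableOn_rpow_mul_exp_neg_mul_rpow (by linarith) one_pos (by positivity)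
  refine Integrable.mono' hg (gigW_meas r b) ?_
  filter_upwards [ae_restrict_mem measurableSet_Ioi] with u hu
  have hu : 0 < u := hu
  rw [Real.norm_of_nonneg (gigW_pos r b u hu).le]
  have h1 := Real.pow_div_factorial_le_exp (1 / (2 * u)) (by positivity) k
  unfold gigW
  have e1 : Real.exp (-(b * u + 1 / u) / 2) =
      Real.exp (-(b/2) * u) * (Real.exp (1 / (2 * u)))⁻¹ := by
    rw [← Real.exp_neg, ← Real.exp_add]; congr 1; field_simp; ring
  have h2 : (Real.exp (1 / (2 * u)))⁻¹ ≤ k.factorial * 2 ^ k * u ^ k := by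
    have : (Real.exp (1 / (2 * u)))⁻¹ ≤ ((1 / (2 * u)) ^ k / k.factorial)⁻¹ :=
      inv_anti₀ (by positivity) h1
    refine this.trans (le_of_eq ?_)
    rw [one_div, inv_pow, mul_pow]
    field_simp
  rw [e1, Real.rpow_add hu, Real.rpow_natCast, Real.rpow_one]
  calc u ^ r * (Real.exp (-(b/2) * u) * (Real.exp (1 / (2 * u)))⁻¹)
      ≤ u ^ r * (Real.exp (-(b/2) * u) * (k.factorial * 2 ^ k * u ^ k)) := by gcongr
    _ = _ := by ring

lemma gigJ_nonneg (r b : ℝ) : 0 ≤ gigJ r b :=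
  setIntegral_nonneg measurableSet_Ioi fun u hu => (gigW_pos r b u hu).le

lemma gigJ_pos (r b : ℝ) (hb : 0 < b) : 0 < gigJ r b := by
  unfold gigJ
  rw [setIntegral_pos_iff_support_of_nonneg_ae]
  · have : Function.support (gigW r b) ∩ Set.Ioi 0 = Set.Ioi 0 := by
      apply Set.inter_eq_right.2
      intro u hu
      exact (gigW_pos r b u hu).ne'
    rw [this]; simp
  · filter_upwards [ae_restrict_mem measurableSet_Ioi] with u hu
    exact (gigW_pos r b u hu).le
  · exact gigW_int r b hb

lemma gig_zero (s : ℝ) (hs : 0 < s) : IntegrableOn (gigW (-s - 1) 0) (Set.Ioi 0) ∧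
    gigJ (-s - 1) 0 = 2 ^ s * Real.Gamma s := by
  set g : ℝ → ℝ := fun y => y ^ (s - 1) * Real.exp (-((1/2) * y)) with hg
  have key : Set.EqOn (fun x : ℝ => (|(-1:ℝ)| * x ^ ((-1:ℝ) - 1)) • g (x ^ (-1:ℝ)))
      (gigW (-s - 1) 0) (Set.Ioi 0) := by
    intro x hx
    have hx : 0 < x := hx
    simp only [hg, gigW, smul_eq_mul, abs_neg, abs_one, one_mul]
    rw [← Real.rpow_mul hx.le, ← mul_assoc, ← Real.rpow_add hx, Real.rpow_neg_one]
    congr 2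
    · ring
    · field_simp; ring
  constructor
  · refine (integrableOn_congr_fun key measurableSet_Ioi).1 ?_
    rw [integrableOn_Ioi_comp_rpow_iff g (by norm_num : (-1:ℝ) ≠ 0)]
    have := integrableOn_rpow_mul_exp_neg_mul_rpow (p := 1) (s := s - 1) (b := 1/2)
      (by linarith) one_pos (by norm_num)
    simpa [hg] using this
  · unfold gigJ
    rw [← setIntegral_congr_fun measurableSet_Ioi key, integral_comp_rpow_Ioi g (by norm_num)]
    have := Real.integral_rpow_mul_exp_neg_mul_Ioi hs (by norm_num : (0:ℝ) < 1/2)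
    rw [hg, this]
    norm_num

lemma gig_scale (r a c : ℝ) (hc : 0 < c) :
    ∫ v in Set.Ioi (0:ℝ), v ^ r * Real.exp (-(a * v + c / v) / 2) =
      c ^ (r + 1) * gigJ r (a * c) := by
  have h := integral_comp_mul_left_Ioi
    (fun v : ℝ => v ^ r * Real.exp (-(a * v + c / v) / 2)) 0 hc
  rw [mul_zero] at h
  have h2 : ∫ u in Set.Ioi (0:ℝ), (c * u) ^ r * Real.exp (-(a * (c * u) + c / (c * u)) / 2) =
      c ^ r * gigJ r (a * c) := by
    unfold gigJ
    rw [← integral_const_mul]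
    apply setIntegral_congr_fun measurableSet_Ioi
    intro u hu
    have hu : 0 < u := hu
    simp only [gigW]
    rw [Real.mul_rpow hc.le hu.le, mul_assoc]
    congr 3
    field_simp
  rw [h2, smul_eq_mul] at h
  rw [Real.rpow_add hc, Real.rpow_one, mul_right_comm, h, mul_comm, ← mul_assoc,
    mul_inv_cancel₀ hc.ne', one_mul]

lemma gigW_sub (r d b u : ℝ) (hu : 0 < u) : gigW (r - d) b u = u ^ (-d) * gigW r b u := by
  unfold gigW
  rw [sub_eq_neg_add, Real.rpow_add hu, mul_assoc]

/-- global bound -/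
lemma gig_upper (r d b : ℝ) (hb : 0 < b) (hd : 0 < d) (hd1 : d ≤ 1) :
    gigJ (r - d) b ≤ (b ^ d + 2 * (2:ℝ) ^ (-r) * Real.exp (1/2)) * gigJ r b := by
  set K : ℝ := 4 * (2:ℝ) ^ (-r) * Real.exp (1/2) with hK
  have h2 := integral_comp_mul_left_Ioi (gigW r b) 0 (zero_lt_two)
  rw [mul_zero] at h2
  have hi2 : IntegrableOn (fun u => gigW r b (2 * u)) (Set.Ioi 0) := by
    have := (integrableOn_Ioi_comp_mul_left_iff (gigW r b) 0 (zero_lt_two)).2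
    rw [mul_zero] at this
    exact this (gigW_int r b hb)
  have hpt : ∀ u ∈ Set.Ioi (0:ℝ), gigW (r - d) b u ≤ b ^ d * gigW r b u + K * gigW r b (2 * u) := by
    intro u hu
    have hu : 0 < u := hu
    have hp1 := gigW_pos r b u hu
    have hp2 := gigW_pos r b (2 * u) (by positivity)
    rcases le_or_gt (1 / b) u with h | h
    · have : u ^ (-d) ≤ b ^ d := by
        rw [Real.rpow_neg hu.le, ← Real.inv_rpow hu.le]
        apply Real.rpow_le_rpow (by positivity) _ hd.le
        rw [inv_le_comm₀ hu hb]; simpa using h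
      rw [gigW_sub _ _ _ _ hu]
      have hK0 : 0 ≤ K := by positivity
      nlinarith [mul_le_mul_of_nonneg_right this hp1.le, mul_nonneg hK0 hp2.le]
    · have h3 : u ^ (-d) ≤ 4 * Real.exp (1 / (4 * u)) := by
        rw [Real.rpow_neg hu.le, ← Real.inv_rpow hu.le]
        have hx : 0 < u⁻¹ := by positivity
        have h4 : (u⁻¹) ^ d ≤ 1 + u⁻¹ := by
          rcases le_or_gt u⁻¹ 1 with h5 | h5
          · have := Real.rpow_le_one hx.le h5 hd.le
            linarith
          · have := Real.rpow_le_rpow_of_exponent_le h5.le hd1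
            rw [Real.rpow_one] at this; linarith
        have h5 := Real.add_one_le_exp (1 / (4 * u))
        have h6 : 1 / (4 * u) = u⁻¹ / 4 := by field_simp
        rw [h6] at h5 ⊢
        linarith
      have h4 : gigW (r - d) b u ≤ K * gigW r b (2 * u) := by
        rw [gigW_sub _ _ _ _ hu]
        unfold gigW
        rw [Real.mul_rpow (zero_le_two : (0:ℝ) ≤ 2) hu.le, hK, Real.rpow_neg (zero_le_two : (0:ℝ) ≤ 2)]
        have h2r : (0:ℝ) < 2 ^ r := by positivity
        have hur : (0:ℝ) < u ^ r := by positivity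
        have hbu : b * u ≤ 1 := by rw [lt_div_iff₀ hb] at h; linarith
        calc u ^ (-d) * (u ^ r * Real.exp (-(b * u + 1 / u) / 2))
            ≤ (4 * Real.exp (1 / (4 * u))) * (u ^ r * Real.exp (-(b * u + 1 / u) / 2)) := by gcongr
          _ = 4 * u ^ r * Real.exp (1 / (4 * u) + -(b * u + 1 / u) / 2) := by
              rw [Real.exp_add]; ring
          _ ≤ 4 * u ^ r * Real.exp (1/2 + -(b * (2 * u) + 1 / (2 * u)) / 2) := by
              gcongr ?_ * Real.exp ?_
              have e1 : 1 / (4 * u) = (1/u) / 4 := by field_simp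
              have e2 : 1 / (2 * u) = (1/u) / 2 := by field_simp
              rw [e1, e2]; linarith
          _ = _ := by rw [Real.exp_add]; field_simp
      have := mul_nonneg (Real.rpow_nonneg hb.le d) hp1.le
      linarith
  have h3 := setIntegral_mono_on (gigW_int (r - d) b hb)
    (((gigW_int r b hb).const_mul (b ^ d)).add (hi2.const_mul K)) measurableSet_Ioi hpt
  have h4 : ∫ u in Set.Ioi (0:ℝ), (b ^ d * gigW r b u + K * gigW r b (2 * u)) =
      b ^ d * gigJ r b + K * (2⁻¹ * gigJ r b) := by
    rw [integral_add ((gigW_int r b hb).const_mul (b ^ d)) (hi2.const_mul K),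
      integral_const_mul, integral_const_mul, h2]; rfl
  have h5 : gigJ (r - d) b ≤ b ^ d * gigJ r b + K * (2⁻¹ * gigJ r b) := by
    rw [← h4]; exact h3
  refine h5.trans (le_of_eq ?_)
  rw [hK]; ring

lemma gigJ_log (r b : ℝ) (hr : -1 ≤ r) (hb : 0 < b) (hb1 : b < 1) :
    Real.exp (-1) * Real.log (1 / b) ≤ gigJ r b := by
  have h1b : 1 ≤ 1 / b := by rw [le_div_iff₀ hb]; linarith
  have h1 : ∫ u in Set.Ioc 1 (1/b), Real.exp (-1) * u⁻¹ = Real.exp (-1) * Real.log (1 / b) := by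
    rw [integral_const_mul, ← intervalIntegral.integral_of_le h1b,
      integral_inv_of_pos one_pos (by positivity), div_one]
  rw [← h1]
  have hsub : Set.Ioc 1 (1/b) ⊆ Set.Ioi (0:ℝ) := fun u hu => lt_trans one_pos hu.1
  refine le_trans ?_ (setIntegral_mono_set (gigW_int r b hb) ?_ hsub.eventuallyLE)
  · refine setIntegral_mono_on ?_ ((gigW_int r b hb).mono_set hsub) measurableSet_Ioc ?_
    · apply IntegrableOn.mono_set _ Set.Ioc_subset_Icc_self
      apply ContinuousOn.integrableOn_Icc
      intro u hu
      have : u ≠ 0 := by have := hu.1; positivity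
      apply ContinuousAt.continuousWithinAt
      fun_prop (disch := assumption)
    · intro u hu
      have hu1 : 1 < u := hu.1
      have hu0 : 0 < u := by linarith
      have hbu : b * u ≤ 1 := by have := hu.2; rw [le_div_iff₀ hb] at this; linarith
      have hiu : 1 / u ≤ 1 := by rw [div_le_one hu0]; exact hu1.le
      unfold gigW
      rw [mul_comm, ← Real.rpow_neg_one]
      gcongr
      · exact hu1.le
      · linarith
  · filter_upwards [ae_restrict_mem measurableSet_Ioi] with u hu
    exact (gigW_pos r b u hu).le

lemma gig_small_nonneg (r d ε : ℝ) (hr : -1 ≤ r) (hd : 0 < d) (hε : 0 < ε) :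
    ∃ b₀ > 0, ∀ b, 0 < b → b < b₀ → gigJ (r - d) b ≤ ε * gigJ r b := by
  set T : ℝ := (ε/2) ^ (-1/d) with hT
  have hT0 : 0 < T := by positivity
  set K : ℝ := Real.exp (T/2) * gigJ (r - d) 1 with hK
  refine ⟨min 1 (Real.exp (-(K * (2/ε) * Real.exp 1))), by positivity, fun b hb hb0 => ?_⟩
  have hb1 : b < 1 := hb0.trans_le (min_le_left _ _)
  have hb2 := hb0.trans_le (min_le_right _ _)
  have hlog : K * (2/ε) * Real.exp 1 ≤ Real.log (1/b) := by
    rw [one_div, Real.log_inv]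
    have := (Real.log_lt_iff_lt_exp hb).2 hb2
    linarith
  have hJ := gigJ_log r b hr hb hb1
  have hKJ : K ≤ ε/2 * gigJ r b := by
    have h1 : Real.exp (-1) * (K * (2/ε) * Real.exp 1) ≤ gigJ r b :=
      le_trans (by gcongr) hJ
    have h2 : Real.exp (-1) * (K * (2/ε) * Real.exp 1) = K * (2/ε) := by
      rw [Real.exp_neg]; field_simp
    rw [h2] at h1
    calc K = ε/2 * (K * (2/ε)) := by field_simp
      _ ≤ _ := by gcongr
  have hpt : ∀ u ∈ Set.Ioi (0:ℝ), gigW (r - d) b u ≤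
      ε/2 * gigW r b u + Real.exp (T/2) * gigW (r - d) 1 u := by
    intro u hu
    have hu : 0 < u := hu
    have hp1 := gigW_pos r b u hu
    have hp2 := gigW_pos (r - d) 1 u hu
    rcases le_or_gt T u with h | h
    · have : u ^ (-d) ≤ ε/2 := by
        have h1 : u ^ (-d) ≤ T ^ (-d) :=
          Real.rpow_le_rpow_of_nonpos hT0 h (by linarith)
        have h2 : T ^ (-d) = ε/2 := by
          rw [hT, ← Real.rpow_mul (by positivity)]
          have : -1 / d * -d = 1 := by field_simp
          rw [this, Real.rpow_one]
        linarith
      rw [gigW_sub r d b _ hu]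
      have h3 := mul_le_mul_of_nonneg_right this hp1.le
      have h4 := mul_nonneg (Real.exp_pos (T/2)).le hp2.le
      linarith
    · have : gigW (r - d) b u ≤ Real.exp (T/2) * gigW (r - d) 1 u := by
        unfold gigW
        rw [mul_left_comm, ← Real.exp_add]
        gcongr
        have := mul_pos hb hu
        linarith
      have := mul_nonneg (half_pos hε).le hp1.le
      linarith
  have hi1 := (gigW_int r b hb).const_mul (ε/2)
  have hi2 := (gigW_int (r - d) 1 one_pos).const_mul (Real.exp (T/2))
  have h3 := setIntegral_mono_on (gigW_int (r - d) b hb) (hi1.add hi2) measurableSet_Ioi hpt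
  have h4 : ∫ u in Set.Ioi (0:ℝ), (ε/2 * gigW r b u + Real.exp (T/2) * gigW (r - d) 1 u) =
      ε/2 * gigJ r b + K := by
    rw [integral_add hi1 hi2, integral_const_mul, integral_const_mul]; rfl
  have h5 : gigJ (r - d) b ≤ ε/2 * gigJ r b + K := by
    rw [← h4]; exact h3
  linarith

lemma gigW_le_zero (r b u : ℝ) (hb : 0 ≤ b) (hu : 0 < u) : gigW r b u ≤ gigW r 0 u := by
  unfold gigW
  gcongr

lemma gigJ_tendsto (s : ℝ) (hs : 0 < s) :
    Filter.Tendsto (fun b => gigJ (-s - 1) b) (nhdsWithin 0 (Set.Ioi 0))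
      (nhds (gigJ (-s - 1) 0)) := by
  unfold gigJ
  apply tendsto_integral_filter_of_dominated_convergence (gigW (-s - 1) 0)
  · exact Filter.Eventually.of_forall fun b => gigW_meas _ b
  · filter_upwards [self_mem_nhdsWithin] with b hb
    filter_upwards [ae_restrict_mem measurableSet_Ioi] with u hu
    rw [Real.norm_of_nonneg (gigW_pos _ b u hu).le]
    exact gigW_le_zero _ _ _ (le_of_lt hb) hu
  · exact (gig_zero s hs).1
  · refine Filter.Eventually.of_forall fun u => ?_
    have : Continuous (fun b => gigW (-s - 1) b u) := by
      unfold gigW; fun_prop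
    exact (this.tendsto 0).mono_left nhdsWithin_le_nhds

lemma gig_small_neg (s d C : ℝ) (hs : 0 < s) (hd : 0 < d)
    (hC : 2 ^ d * Real.Gamma (s + d) < C * Real.Gamma s) (hC0 : 0 < C) :
    ∃ b₀ > 0, ∀ b, 0 < b → b < b₀ → gigJ (-s - 1 - d) b ≤ C * gigJ (-s - 1) b := by
  have h0 := gig_zero s hs
  have h1 := gig_zero (s + d) (by linarith)
  have e : -(s + d) - 1 = -s - 1 - d := by ring
  rw [e] at h1
  have hlt : gigJ (-s - 1 - d) 0 / C < gigJ (-s - 1) 0 := by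
    rw [div_lt_iff₀ hC0, h0.2, h1.2, Real.rpow_add two_pos]
    have : (0:ℝ) < 2 ^ s := by positivity
    nlinarith
  have hev := (gigJ_tendsto s hs).eventually (lt_mem_nhds hlt)
  rw [eventually_nhdsWithin_iff, Metric.eventually_nhds_iff] at hev
  obtain ⟨b₀, hb₀, h⟩ := hev
  refine ⟨b₀, hb₀, fun b hb hbb => ?_⟩
  have h2 := h (y := b) (by rw [Real.dist_eq, sub_zero, abs_of_pos hb]; exact hbb) hb
  rw [div_lt_iff₀ hC0] at h2
  have h3 : gigJ (-s - 1 - d) b ≤ gigJ (-s - 1 - d) 0 :=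
    setIntegral_mono_on (gigW_int _ b hb) h1.1 measurableSet_Ioi
      fun u hu => gigW_le_zero _ _ _ hb.le hu
  linarith

lemma Gamma_strict (x y : ℝ) (hx : 0 < x) (hy : 0 < y) (hxy : x ≠ y) :
    Real.Gamma ((x + y) / 2) ^ 2 < Real.Gamma x * Real.Gamma y := by
  have h := Real.Gamma_mul_add_mul_le_rpow_Gamma_mul_rpow_Gamma (s := x + 1) (t := y + 1)
    (a := 1/2) (b := 1/2) (by linarith) (by linarith) (by norm_num) (by norm_num) (by norm_num)
  have e : 1/2 * (x + 1) + 1/2 * (y + 1) = (x + y)/2 + 1 := by ring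
  have hm : 0 < (x + y)/2 := by linarith
  have gx := Real.Gamma_pos_of_pos hx
  have gy := Real.Gamma_pos_of_pos hy
  have gm := Real.Gamma_pos_of_pos hm
  rw [e, ← Real.sqrt_eq_rpow, ← Real.sqrt_eq_rpow, Real.Gamma_add_one hx.ne',
    Real.Gamma_add_one hy.ne', Real.Gamma_add_one hm.ne'] at h
  have h2 := pow_le_pow_left₀ (by positivity) h 2
  rw [mul_pow (√_), Real.sq_sqrt (by positivity), Real.sq_sqrt (by positivity), mul_pow] at h2
  have h3 : x * y < ((x + y)/2)^2 := by
    have : 0 < (x - y)^2 := by have := sub_ne_zero.2 hxy; positivity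
    nlinarith
  have hxyp : 0 < x * y := by positivity
  have h4 : (x * y) * Real.Gamma ((x + y)/2)^2 < (x * y) * (Real.Gamma x * Real.Gamma y) := by
    have : (x * y) * Real.Gamma ((x + y)/2)^2 < ((x + y)/2)^2 * Real.Gamma ((x + y)/2)^2 := by
      gcongr
    linarith
  exact lt_of_mul_lt_mul_left h4 hxyp.le

lemma deltaP_pos (p : ℝ) (hp : 0 < p) : 0 < deltaP p ∧ deltaP p ≤ 1/2 := by
  unfold deltaP
  split_ifs with h
  · exact ⟨hp, h⟩
  · push Not at h
    exact ⟨lt_min (by norm_num) (by linarith), min_le_left _ _⟩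

lemma kappa_pos (δ : ℝ) (h : δ < 1) : 0 < kappa δ := by
  unfold kappa
  have := Real.Gamma_pos_of_pos (show 0 < (1 - δ)/2 by linarith)
  have := Real.pi_pos
  positivity

lemma gig_small (p : ℝ) (hp : 0 < p) : ∃ C₁ : ℝ, 0 < C₁ ∧ C₁ * kappa (deltaP p) < 1 ∧
    ∃ b₀ > 0, ∀ b, 0 < b → b < b₀ →
      gigJ (p - 1/2 - 1 - deltaP p / 2) b ≤ C₁ * gigJ (p - 1/2 - 1) b := by
  obtain ⟨hd0, hd1⟩ := deltaP_pos p hp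
  have hk := kappa_pos (deltaP p) (by linarith)
  rcases le_or_gt (1/2) p with h | h
  · refine ⟨1 / (2 * kappa (deltaP p)), by positivity, ?_, ?_⟩
    · field_simp; norm_num
    · exact gig_small_nonneg _ _ _ (by linarith) (by linarith) (by positivity)
  · have hδ : deltaP p = p := by unfold deltaP; rw [if_pos h.le]
    rw [hδ] at hk ⊢
    set s := 1/2 - p with hs
    have hs0 : 0 < s := by linarith
    have gs := Real.Gamma_pos_of_pos hs0
    have gm := Real.Gamma_pos_of_pos (show 0 < s + p/2 by linarith)
    have hG := Gamma_strict (1/2) s (by norm_num) hs0 (by rw [hs]; linarith)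
    rw [Real.Gamma_one_half_eq, show (1/2 + s)/2 = s + p/2 by rw [hs]; ring] at hG
    have hL : 2 ^ (p/2) * Real.Gamma (s + p/2) / Real.Gamma s < 1 / kappa p := by
      rw [lt_div_iff₀ hk]
      unfold kappa
      rw [show (1 - p)/2 = s + p/2 by rw [hs]; ring, show -p/2 = -(p/2) by ring,
        Real.rpow_neg two_pos.le, Real.rpow_neg Real.pi_pos.le, ← Real.sqrt_eq_rpow]
      have h2 : (0:ℝ) < 2 ^ (p/2) := by positivity
      have hpi : 0 < √Real.pi := Real.sqrt_pos.2 Real.pi_pos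
      have : 2 ^ (p/2) * Real.Gamma (s + p/2) / Real.Gamma s *
          ((√Real.pi)⁻¹ * (2 ^ (p/2))⁻¹ * Real.Gamma (s + p/2)) =
          Real.Gamma (s + p/2) ^ 2 / (√Real.pi * Real.Gamma s) := by
        field_simp
      rw [this, div_lt_one (by positivity)]
      exact hG
    obtain ⟨C, hC1, hC2⟩ := exists_between hL
    have hC0 : 0 < C := lt_trans (by positivity) hC1
    refine ⟨C, hC0, (lt_div_iff₀ hk).1 hC2, ?_⟩
    have := gig_small_neg s (p/2) C hs0 (by linarith) ((div_lt_iff₀ gs).1 hC1) hC0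
    rwa [show -s - 1 = p - 1/2 - 1 by rw [hs]; ring] at this

/-- Negative fractional GIG moment bound: for `p > 0` there are constants
`C₁ > 0` (depending only on `p`) with `C₁ κ(δ(p)) < 1` and, for each `a > 0`
(denoted `ã` in the paper), a constant `C₂` (depending on `p, ã`), such that
for all `σ > 0` and `M ≠ 0`,
`E_{GIG(p−1/2, ã, (M/σ)²)}[v^{−δ(p)/2}] ≤ C₁ |M/σ|^{−δ(p)} + C₂`. -/
theorem stmt8 (p : ℝ) (hp : 0 < p) :
    ∃ C₁ : ℝ, 0 < C₁ ∧ C₁ * kappa (deltaP p) < 1 ∧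
      ∀ a : ℝ, 0 < a → ∃ C₂ : ℝ, ∀ σ M : ℝ, 0 < σ → M ≠ 0 →
        gigExp (p - 1/2) a ((M/σ) ^ 2) (fun v => v ^ (-(deltaP p)/2))
          ≤ C₁ * |M/σ| ^ (-(deltaP p)) + C₂ := by
  obtain ⟨C₁, hC0, hC1, b₀, hb₀, hsm⟩ := gig_small p hp
  refine ⟨C₁, hC0, hC1, fun a ha => ?_⟩
  obtain ⟨hd0, hd1⟩ := deltaP_pos p hp
  set d := deltaP p / 2 with hd
  set r := p - 1/2 - 1 with hr
  set K : ℝ := 2 * (2:ℝ) ^ (-r) * Real.exp (1/2) with hK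
  have hK0 : 0 < K := by positivity
  set C := 1 + K * b₀ ^ (-d) with hC
  have hCp : 0 < C := by positivity
  have main : ∀ b, 0 < b → gigJ (r - d) b ≤ (C₁ + C * b ^ d) * gigJ r b := by
    intro b hb
    have hJ := gigJ_pos r b hb
    rcases lt_or_ge b b₀ with h | h
    · refine (hsm b hb h).trans ?_
      gcongr
      have : 0 < C * b ^ d := by positivity
      linarith
    · refine (gig_upper r d b hb (by linarith) (by linarith)).trans ?_
      refine mul_le_mul_of_nonneg_right ?_ hJ.le
      have h1 : b₀ ^ d ≤ b ^ d := Real.rpow_le_rpow hb₀.le h (by linarith)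
      have h2 : b₀ ^ (-d) * b₀ ^ d = 1 := by
        rw [← Real.rpow_add hb₀]; simp
      have h3 : 1 ≤ b₀ ^ (-d) * b ^ d := by
        rw [← h2]; gcongr
      have h4 : K ≤ K * (b₀ ^ (-d) * b ^ d) := le_mul_of_one_le_right hK0.le h3
      rw [← hK, hC]
      linarith
  refine ⟨C * a ^ d, fun σ M hσ hM => ?_⟩
  have hm : M / σ ≠ 0 := div_ne_zero hM hσ.ne'
  set c := (M/σ)^2 with hc
  have hc0 : 0 < c := by positivity
  have hcd : |M/σ| ^ (-(deltaP p)) = c ^ (-d) := by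
    rw [hc, ← sq_abs, ← Real.rpow_natCast, ← Real.rpow_mul (abs_nonneg _)]
    congr 1; rw [hd]; push_cast; ring
  rw [hcd]
  unfold gigExp
  have hnum : ∫ v in Set.Ioi (0:ℝ), v ^ (-(deltaP p)/2) * v ^ (p - 1/2 - 1) *
      Real.exp (-(a * v + c / v) / 2) = c ^ (r - d + 1) * gigJ (r - d) (a * c) := by
    rw [← gig_scale _ _ _ hc0]
    apply setIntegral_congr_fun measurableSet_Ioi
    intro v hv
    have hv : 0 < v := hv
    simp only
    rw [← Real.rpow_add hv]
    congr 2
    rw [hd, hr]; ring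
  have hden := gig_scale r a c hc0
  rw [hnum, hden]
  have hJ := gigJ_pos r (a * c) (by positivity)
  have hcr : 0 < c ^ (r + 1) := by positivity
  rw [div_le_iff₀ (by positivity)]
  have hm2 := main (a * c) (by positivity)
  have e1 : c ^ (r - d + 1) = c ^ (-d) * c ^ (r + 1) := by
    rw [← Real.rpow_add hc0]; congr 1; ring
  have e2 : c ^ (-d) * c ^ d = 1 := by
    rw [← Real.rpow_add hc0]; simp
  rw [Real.mul_rpow ha.le hc0.le] at hm2
  rw [e1]
  calc c ^ (-d) * c ^ (r + 1) * gigJ (r - d) (a * c)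
      ≤ c ^ (-d) * c ^ (r + 1) * ((C₁ + C * (a ^ d * c ^ d)) * gigJ r (a * c)) := by gcongr
    _ = (C₁ * c ^ (-d) + C * a ^ d * (c ^ (-d) * c ^ d)) * (c ^ (r + 1) * gigJ r (a * c)) := by
        ring
    _ = _ := by rw [e2, mul_one]
end

section
/- Let p < 0, ã > 0, b > 0, σ > 0 and q ∈ (0, 1/2]. Then there exists a finite constant L (depending only on p, ã, b, q) such that for all M ∈ ℝ: E_{GIG(p−1/2, ã, b+(M/σ)²)}[v^{−q}] ≤ L. -/
open MeasureTheory

lemma gig_integrable (s a χ : ℝ) (ha : 0 < a) (hχ : 0 < χ) :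
    IntegrableOn (fun v : ℝ => v ^ s * Real.exp (-(a * v + χ / v) / 2)) (Set.Ioi 0) := by
  obtain ⟨n, hn⟩ := exists_nat_gt (-s)
  have h1 : IntegrableOn (fun v : ℝ => v ^ (s + n) * Real.exp (-(a / 2) * v ^ (1:ℝ)))
      (Set.Ioi 0) :=
    integrableOn_rpow_mul_exp_neg_mul_rpow (by linarith) (by norm_num) (by positivity)
  have h2 := h1.const_mul ((n.factorial : ℝ) * (2 / χ) ^ n)
  refine Integrable.mono' h2 ?_ ?_
  · exact Measurable.aestronglyMeasurable (by fun_prop)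
  · refine (ae_restrict_iff' measurableSet_Ioi).2 (Filter.Eventually.of_forall ?_)
    intro v hv
    have hv : 0 < v := hv
    have hx : 0 < χ / (2 * v) := by positivity
    have h3 := Real.pow_div_factorial_le_exp (χ / (2 * v)) hx.le n
    have hf : (0:ℝ) < n.factorial := by positivity
    have h4 : Real.exp (-(χ / (2 * v))) ≤ n.factorial * (2 / χ) ^ n * v ^ n := by
      rw [Real.exp_neg]
      have : (n.factorial : ℝ) * (2 / χ) ^ n * v ^ n = ((χ / (2 * v)) ^ n / n.factorial)⁻¹ := by
        rw [inv_div, div_pow, div_pow, mul_pow]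
        field_simp
      rw [this]
      exact inv_anti₀ (by positivity) h3
    rw [Real.norm_of_nonneg (by positivity), Real.rpow_add hv, Real.rpow_natCast, Real.rpow_one]
    have h5 : Real.exp (-(a * v + χ / v) / 2)
        = Real.exp (-(a / 2) * v) * Real.exp (-(χ / (2 * v))) := by
      rw [← Real.exp_add]; congr 1; field_simp; ring
    rw [h5]
    have h6 := mul_le_mul_of_nonneg_left h4
      (show 0 ≤ v ^ s * Real.exp (-(a / 2) * v) by positivity)
    calc _ = _ := by ring
      _ ≤ _ := h6
      _ = _ := by ring

lemma gig_pos (s a χ : ℝ) (ha : 0 < a) (hχ : 0 < χ) :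
    0 < ∫ v in Set.Ioi (0:ℝ), v ^ s * Real.exp (-(a * v + χ / v) / 2) := by
  rw [setIntegral_pos_iff_support_of_nonneg_ae _ (gig_integrable s a χ ha hχ)]
  · have : Function.support (fun v : ℝ => v ^ s * Real.exp (-(a * v + χ / v) / 2)) ∩ Set.Ioi 0
        = Set.Ioi 0 := by
      refine Set.inter_eq_right.2 fun v hv => ?_
      have hv : 0 < v := hv
      exact (show 0 < v ^ s * Real.exp (-(a * v + χ / v) / 2) by positivity).ne'
    rw [this]; simp
  · refine (ae_restrict_iff' measurableSet_Ioi).2 (Filter.Eventually.of_forall ?_)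
    intro v hv
    have hv : 0 < v := hv
    show 0 ≤ v ^ s * Real.exp (-(a * v + χ / v) / 2)
    positivity

lemma gig_num (r q a χ : ℝ) :
    (∫ v in Set.Ioi (0:ℝ), v ^ (-q) * v ^ r * Real.exp (-(a * v + χ / v) / 2))
      = ∫ v in Set.Ioi (0:ℝ), v ^ (-q + r) * Real.exp (-(a * v + χ / v) / 2) := by
  refine setIntegral_congr_fun measurableSet_Ioi fun v hv => ?_
  simp only [Real.rpow_add (show 0 < v from hv)]

/-- Uniform negative GIG moment bound: for `p < 0`, `ã > 0`, `b > 0` and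
`q ∈ (0, 1/2]`, there is a finite constant `L` (depending only on `p, ã, b, q`)
such that for all `σ > 0` and all `M ∈ ℝ`:
`E_{GIG(p−1/2, ã, b+(M/σ)²)}[v^{−q}] ≤ L`. -/
theorem stmt9 (p a b q : ℝ) (hp : p < 0) (ha : 0 < a) (hb : 0 < b)
    (hq0 : 0 < q) (hq : q ≤ 1/2) :
    ∃ L : ℝ, ∀ σ M : ℝ, 0 < σ →
      gigExp (p - 1/2) a (b + (M/σ) ^ 2) (fun v => v ^ (-q)) ≤ L := by
  refine ⟨gigExp (p - 1/2) a b (fun v => v ^ (-q)), fun σ M _ => ?_⟩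
  have ht : 0 ≤ (M / σ) ^ 2 := sq_nonneg _
  generalize (M / σ) ^ 2 = t at ht
  unfold gigExp
  simp only [gig_num]
  generalize p - 1/2 - 1 = r
  have hχ : 0 < b + t := by linarith
  have hN0 := gig_pos (-q + r) a b ha hb
  have hD0 := gig_pos r a b ha hb
  have hD1 := gig_pos r a (b + t) ha hχ
  have iN0 := gig_integrable (-q + r) a b ha hb
  have iD0 := gig_integrable r a b ha hb
  have iN1 := gig_integrable (-q + r) a (b + t) ha hχ
  have iD1 := gig_integrable r a (b + t) ha hχ
  set N0 := ∫ v in Set.Ioi (0:ℝ), v ^ (-q + r) * Real.exp (-(a * v + b / v) / 2) with hN0d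
  set D0 := ∫ v in Set.Ioi (0:ℝ), v ^ r * Real.exp (-(a * v + b / v) / 2) with hD0d
  obtain ⟨m, hm⟩ : ∃ m, m = N0 / D0 := ⟨_, rfl⟩
  have hmpos : 0 < m := by rw [hm]; positivity
  rw [← hm, div_le_iff₀ hD1]
  obtain ⟨c, hc, hcm⟩ : ∃ c : ℝ, 0 < c ∧ c ^ (-q) = m := by
    refine ⟨m ^ (-q)⁻¹, by positivity, ?_⟩
    rw [← Real.rpow_mul hmpos.le, inv_mul_cancel₀ (by linarith), Real.rpow_one]
  have key : (∫ v in Set.Ioi (0:ℝ), (v ^ (-q + r) * Real.exp (-(a * v + (b + t) / v) / 2)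
        - m * (v ^ r * Real.exp (-(a * v + (b + t) / v) / 2))))
      ≤ ∫ v in Set.Ioi (0:ℝ), Real.exp (-(t / c) / 2) *
        (v ^ (-q + r) * Real.exp (-(a * v + b / v) / 2)
        - m * (v ^ r * Real.exp (-(a * v + b / v) / 2))) := by
    refine setIntegral_mono_on (iN1.sub (iD1.const_mul m))
      ((iN0.sub (iD0.const_mul m)).const_mul _) measurableSet_Ioi fun v hv => ?_
    have hv : 0 < v := hv
    have he : Real.exp (-(a * v + (b + t) / v) / 2)
        = Real.exp (-(a * v + b / v) / 2) * Real.exp (-(t / v) / 2) := by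
      rw [← Real.exp_add]; congr 1; ring
    rw [he, Real.rpow_add hv, ← hcm]
    have h1 : (v ^ (-q) - c ^ (-q)) * (Real.exp (-(t / v) / 2) - Real.exp (-(t / c) / 2)) ≤ 0 := by
      rcases le_total v c with h | h
      · refine mul_nonpos_of_nonneg_of_nonpos (sub_nonneg.2 ?_) (sub_nonpos.2 ?_)
        · exact Real.rpow_le_rpow_of_nonpos hv h (by linarith)
        · have := div_le_div_of_nonneg_left ht hv h
          exact Real.exp_le_exp.2 (by linarith)
      · refine mul_nonpos_of_nonpos_of_nonneg (sub_nonpos.2 ?_) (sub_nonneg.2 ?_)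
        · exact Real.rpow_le_rpow_of_nonpos hc h (by linarith)
        · have := div_le_div_of_nonneg_left ht hc h
          exact Real.exp_le_exp.2 (by linarith)
    have h2 := mul_nonpos_of_nonneg_of_nonpos
      (show 0 ≤ v ^ r * Real.exp (-(a * v + b / v) / 2) by positivity) h1
    linarith
  rw [integral_sub iN1 (iD1.const_mul m), integral_const_mul, integral_const_mul,
    integral_sub iN0 (iD0.const_mul m), integral_const_mul, ← hN0d, ← hD0d] at key
  have : N0 - m * D0 = 0 := by rw [hm]; field_simp; ring
  rw [this] at key
  linarith
end

section
/- Let p ∈ ℝ, ã > 0, b ≥ 0 and σ > 0. Then there exists a finite constant C (depending only on p and ã) such that for every M ∈ ℝ with b + (M/σ)² > 0: E_{GIG(p−1/2, ã, b+(M/σ)²)}[v] ≤ (1/√ã)|M/σ| + √b/√ã + C/ã. -/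
open MeasureTheory

open Real Set Filter Topology in
lemma gig_bound (s a x : ℝ) (hx : 0 < x) :
    ∃ K r : ℝ, 0 ≤ K ∧ 1 ≤ r ∧ ∀ v : ℝ, 0 < v →
      v ^ s * Real.exp (-(a * v + x / v) / 2) ≤ K * (v ^ r * Real.exp (-(a / 2) * v)) := by
  obtain ⟨n, hn⟩ := exists_nat_ge (1 - s)
  refine ⟨n.factorial / (x / 2) ^ n, s + n, by positivity, by linarith, fun v hv => ?_⟩
  have h := Real.pow_div_factorial_le_exp (x := x / 2 / v) (by positivity) n
  have h2 : Real.exp (-(x / 2 / v)) ≤ n.factorial / (x / 2) ^ n * v ^ n := by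
    rw [Real.exp_neg]
    refine (inv_anti₀ (by positivity) h).trans (le_of_eq ?_)
    rw [div_pow]
    field_simp
  have h3 : Real.exp (-(a * v + x / v) / 2)
      = Real.exp (-(a / 2) * v) * Real.exp (-(x / 2 / v)) := by
    rw [← Real.exp_add]; congr 1; ring
  rw [h3, Real.rpow_add hv, Real.rpow_natCast]
  have h4 : 0 ≤ v ^ s * Real.exp (-(a / 2) * v) := by positivity
  calc _ = v ^ s * Real.exp (-(a / 2) * v) * Real.exp (-(x / 2 / v)) := by ring
    _ ≤ v ^ s * Real.exp (-(a / 2) * v) * (n.factorial / (x / 2) ^ n * v ^ n) :=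
      mul_le_mul_of_nonneg_left h2 h4
    _ = _ := by ring

lemma gig_meas (s a x : ℝ) :
    Measurable (fun v : ℝ => v ^ s * Real.exp (-(a * v + x / v) / 2)) := by
  fun_prop

lemma gig_int (s a x : ℝ) (ha : 0 < a) (hx : 0 < x) :
    IntegrableOn (fun v : ℝ => v ^ s * Real.exp (-(a * v + x / v) / 2)) (Set.Ioi 0) := by
  obtain ⟨K, r, hK, hr, h⟩ := gig_bound s a x hx
  have h1 := (integrableOn_rpow_mul_exp_neg_mul_rpow (p := 1) (s := r) (b := a / 2)
    (by linarith) one_pos (by positivity)).const_mul K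
  refine Integrable.mono' h1 (gig_meas s a x).aestronglyMeasurable ?_
  filter_upwards [ae_restrict_mem measurableSet_Ioi] with v hv
  have hv : 0 < v := hv
  rw [Real.norm_of_nonneg (by positivity), Real.rpow_one]
  exact h v hv

/-- Primitive used in the Stein identity. -/
noncomputable def gigH (s a x m v : ℝ) : ℝ :=
  (2 / a) * (v ^ 2 / (v + m)) * (v ^ s * Real.exp (-(a * v + x / v) / 2))

lemma gigH_bound (s a x m : ℝ) (ha : 0 < a) (hx : 0 < x) (hm : 0 < m) :
    ∃ K r : ℝ, 1 ≤ r ∧ ∀ v : ℝ, 0 ≤ v →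
      0 ≤ gigH s a x m v ∧ gigH s a x m v ≤ K * (v ^ r * Real.exp (-(a / 2) * v)) := by
  obtain ⟨K, r, hK, hr, h⟩ := gig_bound s a x hx
  refine ⟨2 / a * K, r + 1, by linarith, fun v hv => ⟨by unfold gigH; positivity, ?_⟩⟩
  rcases hv.eq_or_lt with rfl | hv
  · simp [gigH, Real.zero_rpow (by linarith : r + 1 ≠ 0)]
  · unfold gigH
    have h1 : v ^ 2 / (v + m) ≤ v := by
      rw [div_le_iff₀ (by positivity)]; nlinarith [mul_pos hv hm]
    rw [Real.rpow_add hv, Real.rpow_one]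
    calc _ ≤ (2 / a) * v * (K * (v ^ r * Real.exp (-(a / 2) * v))) := by
          exact mul_le_mul (mul_le_mul_of_nonneg_left h1 (by positivity)) (h v hv)
            (by positivity) (by positivity)
      _ = _ := by ring

open Filter Topology in
lemma gigH_zero (s a x m : ℝ) (ha : 0 < a) (hx : 0 < x) (hm : 0 < m) :
    ContinuousWithinAt (gigH s a x m) (Set.Ici 0) 0 := by
  obtain ⟨K, r, hr, h⟩ := gigH_bound s a x m ha hx hm
  have h0 : gigH s a x m 0 = 0 := by simp [gigH]
  unfold ContinuousWithinAt
  rw [h0]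
  have hc : ContinuousAt (fun v : ℝ => K * (v ^ r * Real.exp (-(a / 2) * v))) 0 := by
    have : ContinuousAt (fun v : ℝ => v ^ r) 0 :=
      Real.continuousAt_rpow_const _ _ (Or.inr (by linarith))
    fun_prop
  have hc2 := hc.tendsto.mono_left (nhdsWithin_le_nhds (s := Set.Ici 0))
  rw [Real.zero_rpow (by linarith)] at hc2
  simp only [zero_mul, mul_zero] at hc2
  refine tendsto_of_tendsto_of_tendsto_of_le_of_le' tendsto_const_nhds hc2 ?_ ?_
  · filter_upwards [self_mem_nhdsWithin] with v hv using (h v hv).1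
  · filter_upwards [self_mem_nhdsWithin] with v hv using (h v hv).2

open Filter Topology in
lemma gigH_top (s a x m : ℝ) (ha : 0 < a) (hx : 0 < x) (hm : 0 < m) :
    Tendsto (gigH s a x m) atTop (𝓝 0) := by
  obtain ⟨K, r, hr, h⟩ := gigH_bound s a x m ha hx hm
  have hc2 := (tendsto_rpow_mul_exp_neg_mul_atTop_nhds_zero r (a / 2) (by positivity)).const_mul K
  rw [mul_zero] at hc2
  refine tendsto_of_tendsto_of_tendsto_of_le_of_le' tendsto_const_nhds hc2 ?_ ?_
  · filter_upwards [eventually_ge_atTop 0] with v hv using (h v hv).1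
  · filter_upwards [eventually_ge_atTop 0] with v hv using (h v hv).2

lemma gigH_deriv (s a m v : ℝ) (ha : 0 < a) (hm : 0 < m) (hv : 0 < v) :
    HasDerivAt (gigH s a (a * m ^ 2) m)
      ((2 / a * ((v ^ 2 + 2 * v * m) / (v + m) ^ 2 + s * (v / (v + m))) + m - v) *
        (v ^ s * Real.exp (-(a * v + (a * m ^ 2) / v) / 2))) v := by
  have hvm : v + m ≠ 0 := by positivity
  have h1 : HasDerivAt (fun v : ℝ => v ^ 2 / (v + m))
      ((2 * v * (v + m) - v ^ 2 * 1) / (v + m) ^ 2) v := by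
    have := (hasDerivAt_pow 2 v).div ((hasDerivAt_id v).add_const m) hvm
    refine HasDerivAt.congr_deriv (f' := _) this ?_
    simp
  have h2 : HasDerivAt (fun v : ℝ => v ^ s) (s * v ^ (s - 1)) v :=
    Real.hasDerivAt_rpow_const (Or.inl hv.ne')
  have h3 : HasDerivAt (fun v : ℝ => -(a * v + (a * m ^ 2) / v) / 2)
      (-(a + (a * m ^ 2) * (-(v ^ 2)⁻¹)) / 2) v := by
    have := ((((hasDerivAt_id v).const_mul a).add
      ((hasDerivAt_inv hv.ne').const_mul (a * m ^ 2))).neg).div_const 2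
    simpa [div_eq_mul_inv] using this
  have h4 := (h1.const_mul (2 / a)).mul (h2.mul h3.exp)
  refine h4.congr_deriv ?_
  rw [Real.rpow_sub_one hv.ne']
  simp only [Pi.mul_apply]
  field_simp
  ring

lemma gig_main (s a m : ℝ) (ha : 0 < a) (hm : 0 < m) :
    ∫ v in Set.Ioi (0:ℝ), v * v ^ s * Real.exp (-(a * v + (a * m ^ 2) / v) / 2) ≤
    (2 / a * (1 + |s|) + m) *
      ∫ v in Set.Ioi (0:ℝ), v ^ s * Real.exp (-(a * v + (a * m ^ 2) / v) / 2) := by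
  have hx : 0 < a * m ^ 2 := by positivity
  have i0 := gig_int s a (a * m ^ 2) ha hx
  have i1 : IntegrableOn (fun v : ℝ => v * v ^ s * Real.exp (-(a * v + (a * m ^ 2) / v) / 2))
      (Set.Ioi 0) := by
    refine (gig_int (s + 1) a (a * m ^ 2) ha hx).congr_fun (fun v hv => ?_) measurableSet_Ioi
    have hv : 0 < v := hv
    simp only [Real.rpow_add_one hv.ne']
    ring
  set c := 2 / a * (1 + |s|) + m with hc
  have key : ∀ v : ℝ, 0 < v →
      |2 / a * ((v ^ 2 + 2 * v * m) / (v + m) ^ 2 + s * (v / (v + m)))| ≤ 2 / a * (1 + |s|) := by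
    intro v hv
    have e1 : (v ^ 2 + 2 * v * m) / (v + m) ^ 2 ≤ 1 := by
      rw [div_le_one (by positivity)]; nlinarith [sq_nonneg m]
    have e2 : v / (v + m) ≤ 1 := by
      rw [div_le_one (by positivity)]; linarith
    rw [abs_mul, abs_of_pos (by positivity : 0 < 2 / a)]
    refine mul_le_mul_of_nonneg_left ((abs_add_le _ _).trans ?_) (by positivity)
    rw [abs_mul, abs_of_nonneg (by positivity : 0 ≤ (v ^ 2 + 2 * v * m) / (v + m) ^ 2),
      abs_of_nonneg (by positivity : 0 ≤ v / (v + m))]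
    nlinarith [abs_nonneg s]
  have i2 : IntegrableOn (fun v : ℝ =>
      (2 / a * ((v ^ 2 + 2 * v * m) / (v + m) ^ 2 + s * (v / (v + m))) + m - v) *
        (v ^ s * Real.exp (-(a * v + (a * m ^ 2) / v) / 2))) (Set.Ioi 0) := by
    refine Integrable.mono' ((i0.const_mul c).add i1) ?_ ?_
    · exact Measurable.aestronglyMeasurable (by fun_prop)
    · filter_upwards [ae_restrict_mem measurableSet_Ioi] with v hv
      have hv : 0 < v := hv
      have hp : 0 ≤ v ^ s * Real.exp (-(a * v + (a * m ^ 2) / v) / 2) := by positivity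
      rw [norm_mul, Real.norm_of_nonneg hp, Real.norm_eq_abs]
      have : |2 / a * ((v ^ 2 + 2 * v * m) / (v + m) ^ 2 + s * (v / (v + m))) + m - v| ≤ c + v := by
        have := abs_le.1 (key v hv)
        rw [abs_le]; constructor <;> linarith
      refine (mul_le_mul_of_nonneg_right this hp).trans (le_of_eq ?_)
      simp only [Pi.add_apply]
      ring
  have hI := integral_Ioi_of_hasDerivAt_of_tendsto (gigH_zero s a (a * m ^ 2) m ha hx hm)
    (fun v hv => gigH_deriv s a m v ha hm hv) i2 (gigH_top s a (a * m ^ 2) m ha hx hm)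
  have h0 : gigH s a (a * m ^ 2) m 0 = 0 := by simp [gigH]
  rw [h0, sub_zero] at hI
  have i3 := (i0.const_mul c).sub i1
  have hle := setIntegral_mono_on i2 i3 measurableSet_Ioi (fun v hv => by
    have hv : 0 < v := hv
    have hp : 0 ≤ v ^ s * Real.exp (-(a * v + (a * m ^ 2) / v) / 2) := by positivity
    have := (abs_le.1 (key v hv)).2
    have h5 : 2 / a * ((v ^ 2 + 2 * v * m) / (v + m) ^ 2 + s * (v / (v + m))) + m - v ≤ c - v := by
      linarith
    refine (mul_le_mul_of_nonneg_right h5 hp).trans (le_of_eq ?_)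
    simp only [Pi.sub_apply]
    ring)
  rw [hI] at hle
  simp only [Pi.sub_apply] at hle
  rw [integral_sub (i0.const_mul c) i1, integral_const_mul] at hle
  linarith

/-- Linear first GIG moment bound: for `p ∈ ℝ` and `ã > 0` there is a finite
constant `C` (depending only on `p` and `ã`) such that for all `b ≥ 0`,
`σ > 0` and `M ∈ ℝ` with `b + (M/σ)² > 0`:
`E_{GIG(p−1/2, ã, b+(M/σ)²)}[v] ≤ (1/√ã)|M/σ| + √b/√ã + C/ã`. -/
theorem stmt10 (p a : ℝ) (ha : 0 < a) :
    ∃ C : ℝ, ∀ b σ M : ℝ, 0 ≤ b → 0 < σ → 0 < b + (M/σ) ^ 2 →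
      gigExp (p - 1/2) a (b + (M/σ) ^ 2) (fun v => v)
        ≤ (1 / Real.sqrt a) * |M/σ| + Real.sqrt b / Real.sqrt a + C / a := by
  refine ⟨2 * (1 + |p - 1 / 2 - 1|), fun b σ M hb hσ hx => ?_⟩
  generalize M / σ = y at hx ⊢
  set m := Real.sqrt (b + y ^ 2) / Real.sqrt a with hm
  have hsa : 0 < Real.sqrt a := Real.sqrt_pos.2 ha
  have hmpos : 0 < m := div_pos (Real.sqrt_pos.2 hx) hsa
  have hxm : b + y ^ 2 = a * m ^ 2 := by
    rw [hm, div_pow, Real.sq_sqrt hx.le, Real.sq_sqrt ha.le]; field_simp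
  have hmle : m ≤ (1 / Real.sqrt a) * |y| + Real.sqrt b / Real.sqrt a := by
    have : Real.sqrt (b + y ^ 2) ≤ Real.sqrt b + |y| := by
      rw [Real.sqrt_le_left (by positivity)]
      nlinarith [Real.sq_sqrt hb, sq_abs y, mul_nonneg (Real.sqrt_nonneg b) (abs_nonneg y)]
    calc m ≤ (Real.sqrt b + |y|) / Real.sqrt a := by rw [hm]; gcongr
      _ = _ := by ring
  have hmain := gig_main (p - 1 / 2 - 1) a m ha hmpos
  rw [← hxm] at hmain
  have hc : 0 ≤ 2 / a * (1 + |p - 1 / 2 - 1|) + m := by positivity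
  have : gigExp (p - 1/2) a (b + y ^ 2) (fun v => v) ≤ 2 / a * (1 + |p - 1 / 2 - 1|) + m := by
    unfold gigExp
    refine div_le_of_le_mul₀ ?_ hc hmain
    refine setIntegral_nonneg measurableSet_Ioi (fun v hv => ?_)
    have hv : 0 < v := hv
    positivity
  have e : 2 * (1 + |p - 1 / 2 - 1|) / a = 2 / a * (1 + |p - 1 / 2 - 1|) := by ring
  rw [e]
  linarith
end

section
/- Let ρ > 0, let B be a real m×n matrix, let V = (V₁,…,Vₙ) ∈ (0,∞)ⁿ with D_V = diag(V₁,…,Vₙ), set Q̄ := ρBᵀB + D_V⁻¹, and let u ∈ ℝⁿ. Then ‖Q̄⁻¹u‖₁ ≤ √(Σ_{i=1}^n V_i) · √(uᵀ Q̄⁻¹ u). -/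
open Matrix

/-- `ℓ¹`-duality bound: with `Q̄ := ρBᵀB + D_V⁻¹`,
`‖Q̄⁻¹u‖₁ ≤ √(Σᵢ Vᵢ) · √(uᵀQ̄⁻¹u)`. -/
theorem stmt11 {m n : ℕ} (ρ : ℝ) (hρ : 0 < ρ) (B : Matrix (Fin m) (Fin n) ℝ)
    (V : Fin n → ℝ) (hV : ∀ i, 0 < V i) (u : Fin n → ℝ) :
    (∑ i, |((ρ • (Bᵀ * B) + Matrix.diagonal (fun i => (V i)⁻¹))⁻¹ *ᵥ u) i|)
      ≤ Real.sqrt (∑ i, V i) *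
        Real.sqrt (u ⬝ᵥ ((ρ • (Bᵀ * B) + Matrix.diagonal (fun i => (V i)⁻¹))⁻¹ *ᵥ u)) := by
  set Q := ρ • (Bᵀ * B) + Matrix.diagonal (fun i => (V i)⁻¹) with hQ
  have hpd : Q.PosDef := by
    have h1 : (ρ • (Bᵀ * B)).PosSemidef := by
      have h := Matrix.posSemidef_conjTranspose_mul_self B
      rw [Matrix.conjTranspose_eq_transpose_of_trivial] at h
      exact h.smul hρ.le
    have h2 : (Matrix.diagonal (fun i => (V i)⁻¹)).PosDef :=
      Matrix.PosDef.diagonal (fun i => inv_pos.mpr (hV i))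
    exact Matrix.PosDef.posSemidef_add h1 h2
  have hdet : IsUnit Q.det := hpd.det_pos.ne'.isUnit
  set x := Q⁻¹ *ᵥ u with hx
  have hu : u = Q *ᵥ x := by
    rw [hx, Matrix.mulVec_mulVec, Matrix.mul_nonsing_inv _ hdet, Matrix.one_mulVec]
  have hle : ∑ i, (x i)^2 * (V i)⁻¹ ≤ u ⬝ᵥ x := by
    have e1 : u ⬝ᵥ x = ρ * ((B *ᵥ x) ⬝ᵥ (B *ᵥ x)) + ∑ i, (x i)^2 * (V i)⁻¹ := by
      rw [hu, hQ, Matrix.add_mulVec, add_dotProduct, Matrix.smul_mulVec, smul_dotProduct,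
        smul_eq_mul, ← Matrix.mulVec_mulVec, Matrix.mulVec_transpose,
        ← Matrix.dotProduct_mulVec]
      congr 1
      simp only [dotProduct, Matrix.mulVec_diagonal]
      exact Finset.sum_congr rfl fun i _ => by ring
    have e2 : 0 ≤ (B *ᵥ x) ⬝ᵥ (B *ᵥ x) :=
      Finset.sum_nonneg fun i _ => mul_self_nonneg _
    have := mul_nonneg hρ.le e2
    linarith
  have hV0 : 0 ≤ ∑ i, V i := Finset.sum_nonneg fun i _ => (hV i).le
  rw [← Real.sqrt_mul hV0]
  apply Real.le_sqrt_of_sq_le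
  refine le_trans ?_ (mul_le_mul_of_nonneg_left hle hV0)
  apply Finset.sum_sq_le_sum_mul_sum_of_sq_eq_mul
  · exact fun i _ => (hV i).le
  · exact fun i _ => mul_nonneg (sq_nonneg _) (inv_pos.mpr (hV i)).le
  · intro i _
    have := (hV i).ne'
    rw [sq_abs]
    field_simp
end

section
/- Let A be an n×n real symmetric positive-semidefinite matrix, let i ≠ j be indices in {1,…,n}, and let ω ⊆ {1,…,n} be a subset with i ∉ ω and j ∉ ω. For index sets σ, τ, let A(σ|τ) denote the submatrix of A obtained by deleting the rows with indices in σ and the columns with indices in τ. Then det(A(ω∪{i} | ω∪{i})) · det(A(ω∪{j} | ω∪{j})) ≥ ( det(A(ω∪{i} | ω∪{j})) )². -/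
open Matrix
open scoped MatrixOrder Matrix.Norms.L2Operator

lemma aux_adj {m : ℕ} (C : Matrix (Fin m) (Fin m) ℝ) (hC : C.PosSemidef) (p q : Fin m) :
    (C.adjugate p q) ^ 2 ≤ C.adjugate p p * C.adjugate q q := by
  obtain ⟨B, rfl⟩ := CStarAlgebra.nonneg_iff_eq_star_mul_self.mp hC.nonneg
  rw [star_eq_conjTranspose, adjugate_mul_distrib, ← adjugate_conjTranspose]
  simp only [mul_apply, conjTranspose_apply, star_trivial]
  have := Finset.sum_mul_sq_le_sq_mul_sq Finset.univ (fun k => B.adjugate p k)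
    (fun k => B.adjugate q k)
  simpa [sq] using this

lemma aux_emb {n m : ℕ} (i : Fin n) (ω : Finset (Fin n)) (hc : (ωᶜ).card = m + 1)
    (p : Fin (m + 1)) (hp : (ωᶜ).orderEmbOfFin hc p = i)
    (h1 : ((insert i ω)ᶜ).card = m) :
    (fun k : Fin m => ((((insert i ω)ᶜ).orderIsoOfFin h1 k : Fin n)))
      = fun k => (ωᶜ).orderEmbOfFin hc (p.succAbove k) := by
  have := Finset.orderEmbOfFin_unique h1
    (f := fun k => (ωᶜ).orderEmbOfFin hc (p.succAbove k)) ?_ ?_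
  · rw [this]; rfl
  · intro k
    have h3 := Finset.orderEmbOfFin_mem (ωᶜ) hc (p.succAbove k)
    rw [Finset.mem_compl] at h3 ⊢
    rw [Finset.mem_insert, not_or]
    refine ⟨?_, h3⟩
    rw [← hp]
    intro h
    exact Fin.succAbove_ne p k (((ωᶜ).orderEmbOfFin hc).injective h)
  · exact ((ωᶜ).orderEmbOfFin hc).strictMono.comp (Fin.strictMono_succAbove p)

/-- Cauchy–Schwarz inequality for minors of a symmetric positive-semidefinite
matrix: with `A(σ|τ)` the submatrix deleting rows in `σ` and columns in `τ`
(rows/columns taken in increasing order),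
`det A(ω∪{i}|ω∪{i}) · det A(ω∪{j}|ω∪{j}) ≥ (det A(ω∪{i}|ω∪{j}))²`. -/
theorem stmt19 {n : ℕ} (A : Matrix (Fin n) (Fin n) ℝ) (hA : A.PosSemidef)
    (i j : Fin n) (hij : i ≠ j) (ω : Finset (Fin n)) (hi : i ∉ ω) (hj : j ∉ ω)
    (m : ℕ) (h1 : ((insert i ω)ᶜ).card = m) (h2 : ((insert j ω)ᶜ).card = m) :
    (Matrix.det (A.submatrix
        (fun k : Fin m => ((((insert i ω)ᶜ).orderIsoOfFin h1 k : Fin n)))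
        (fun k : Fin m => ((((insert j ω)ᶜ).orderIsoOfFin h2 k : Fin n))))) ^ 2
      ≤ Matrix.det (A.submatrix
            (fun k : Fin m => ((((insert i ω)ᶜ).orderIsoOfFin h1 k : Fin n)))
            (fun k : Fin m => ((((insert i ω)ᶜ).orderIsoOfFin h1 k : Fin n))))
        * Matrix.det (A.submatrix
            (fun k : Fin m => ((((insert j ω)ᶜ).orderIsoOfFin h2 k : Fin n)))
            (fun k : Fin m => ((((insert j ω)ᶜ).orderIsoOfFin h2 k : Fin n)))) := by
  have hc : (ωᶜ).card = m + 1 := by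
    have h3 := Finset.card_compl_add_card (insert i ω)
    have h4 := Finset.card_compl_add_card ω
    rw [Finset.card_insert_of_notMem hi] at h3
    omega
  have hr : ∀ x, x ∉ ω → ∃ p, (ωᶜ).orderEmbOfFin hc p = x := by
    intro x hx
    have : x ∈ Set.range ((ωᶜ).orderEmbOfFin hc) := by
      rw [Finset.range_orderEmbOfFin]; simpa using hx
    exact this
  obtain ⟨p, hp⟩ := hr i hi
  obtain ⟨q, hq⟩ := hr j hj
  rw [aux_emb i ω hc p hp h1, aux_emb j ω hc q hq h2]
  have key := aux_adj (A.submatrix ((ωᶜ).orderEmbOfFin hc) ((ωᶜ).orderEmbOfFin hc))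
    (hA.submatrix _) q p
  simp only [adjugate_fin_succ_eq_det_submatrix, submatrix_submatrix, mul_pow, ← pow_mul,
    Even.neg_one_pow (Even.mul_left even_two _), Even.neg_one_pow (Even.add_self _), one_mul] at key
  rw [mul_comm]
  exact key
end
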